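/- arXiv:1610.01521 — 9 statements merged into one kernel-verified Lean document; each statement's English description precedes it below -/
import Mathlib

section
/- Let ε > 0 be fixed. There exists a constant c(ε) > 0 such that for every δ > 0 there exists n0 with the following property: for every n ≥ n0 and every p with c(ε)/n ≤ p ≤ 1, if A is a random subset of {0,1,2}^n in which each element is included independently with probability p (i.e., A is distributed according to the product over {0,1,2}^n of Bernoulli(p) distributions), then with probability at least 1 − δ every antichain contained in A has cardinality at most (1+ε)·p·ℓ_n(n). -/
open MeasureTheory ProbabilityTheory

/-- `ℓ_i(n)`: the number of elements of `{0,1,2}^n` whose coordinates sum to `i`. -/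
noncomputable def ell (n i : ℕ) : ℕ :=
  Nat.card {x : Fin n → Fin 3 // ∑ j, (x j : ℕ) = i}

/-- The sum of the coordinates of an element of `{0,1,2}^n`. -/
def coordSum {n : ℕ} (x : Fin n → Fin 3) : ℕ := ∑ j, (x j : ℕ)

/-- The number of coordinates at which `x` takes the value `v`. -/
def valueCount {n : ℕ} (x : Fin n → Fin 3) (v : Fin 3) : ℕ :=
  (Finset.univ.filter fun j => x j = v).card

lemma valueCount_add {n : ℕ} (x : Fin n → Fin 3) :
    valueCount x 0 + valueCount x 1 + valueCount x 2 = n := by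
  have h := Finset.card_eq_sum_card_fiberwise (s := (Finset.univ : Finset (Fin n)))
    (t := (Finset.univ : Finset (Fin 3))) (f := x) (by simp [Set.MapsTo])
  simp only [Finset.card_univ, Fintype.card_fin, Fin.sum_univ_three] at h
  exact h.symm

lemma coordSum_eq_valueCount {n : ℕ} (x : Fin n → Fin 3) :
    coordSum x = valueCount x 1 + 2 * valueCount x 2 := by
  have h : ∀ j, (x j : ℕ) = (if x j = 1 then 1 else 0) + 2 * (if x j = 2 then 1 else 0) := by
    intro j
    generalize x j = a
    revert a
    decide
  unfold coordSum valueCount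
  rw [Finset.sum_congr rfl fun j _ => h j, Finset.sum_add_distrib, ← Finset.mul_sum]
  simp

lemma coordSum_comp_perm {n : ℕ} (x : Fin n → Fin 3) (σ : Equiv.Perm (Fin n)) :
    coordSum (x ∘ σ) = coordSum x :=
  Equiv.sum_comp σ fun j => (x j : ℕ)

lemma coordSum_le {n : ℕ} (x : Fin n → Fin 3) : coordSum x ≤ 2 * n := by
  have := valueCount_add x
  have := coordSum_eq_valueCount x
  omega

lemma eq_of_le_of_coordSum_eq {n : ℕ} {x y : Fin n → Fin 3} (h : x ≤ y)
    (hr : coordSum x = coordSum y) : x = y := by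
  have := (Finset.sum_eq_sum_iff_of_le fun j (_ : j ∈ Finset.univ) =>
    (show (x j : ℕ) ≤ y j from h j)).1 hr
  exact funext fun j => Fin.ext (this j (Finset.mem_univ j))

/-- The order-reversing involution of `{0,1,2}^n`. -/
def reflect {n : ℕ} (x : Fin n → Fin 3) : Fin n → Fin 3 := fun j => (x j).rev

lemma reflect_reflect {n : ℕ} (x : Fin n → Fin 3) : reflect (reflect x) = x := by
  funext j; simp [reflect]

lemma reflect_le_reflect {n : ℕ} {x y : Fin n → Fin 3} :
    reflect x ≤ reflect y ↔ y ≤ x := by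
  simp [reflect, Pi.le_def]

lemma coordSum_reflect {n : ℕ} (x : Fin n → Fin 3) : coordSum (reflect x) + coordSum x = 2 * n := by
  have h : ∀ j, ((x j).rev : ℕ) + (x j : ℕ) = 2 := by intro j; simp [Fin.rev]; omega
  unfold coordSum reflect
  rw [← Finset.sum_add_distrib, Finset.sum_congr rfl fun j _ => h j]
  simp [mul_comm]

lemma card_filter_ne_zero {n : ℕ} (x : Fin n → Fin 3) :
    (Finset.univ.filter fun j => x j ≠ 0).card = n - valueCount x 0 := by
  have := Finset.card_filter_add_card_filter_not (s := (Finset.univ : Finset (Fin n)))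
    (fun j => x j = 0)
  simp only [Finset.card_univ, Fintype.card_fin] at this
  unfold valueCount
  simp only [ne_eq]
  omega

lemma card_filter_ne_two {n : ℕ} (x : Fin n → Fin 3) :
    (Finset.univ.filter fun j => x j ≠ 2).card = n - valueCount x 2 := by
  have := Finset.card_filter_add_card_filter_not (s := (Finset.univ : Finset (Fin n)))
    (fun j => x j = 2)
  simp only [Finset.card_univ, Fintype.card_fin] at this
  unfold valueCount
  simp only [ne_eq]
  omega

lemma exists_ne_of_coordSum_succ {n : ℕ} {x y : Fin n → Fin 3} (h : x ≤ y)
    (hr : coordSum y = coordSum x + 1) :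
    ∃ j, (y j : ℕ) = x j + 1 ∧ ∀ k, k ≠ j → y k = x k := by
  obtain ⟨j, hj⟩ : ∃ j, x j ≠ y j := by
    by_contra! hc
    rw [funext hc] at hr
    omega
  have hj' : (x j : ℕ) < y j := lt_of_le_of_ne (h j) fun e => hj (Fin.ext e)
  unfold coordSum at hr
  rw [← Finset.add_sum_erase _ _ (Finset.mem_univ j),
    ← Finset.add_sum_erase _ (fun j => (x j : ℕ)) (Finset.mem_univ j)] at hr
  have hle : ∀ k ∈ Finset.univ.erase j, (x k : ℕ) ≤ y k := fun k _ => h k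
  have hs := Finset.sum_le_sum hle
  refine ⟨j, by omega, fun k hk => ?_⟩
  have := (Finset.sum_eq_sum_iff_of_le hle).1 (by omega) k (by simp [hk])
  exact Fin.ext this.symm

open Classical in
/-- The number of upper covers of `x` is at least the number of coordinates below `2`. -/
lemma le_card_upper_covers {n : ℕ} (x : Fin n → Fin 3) :
    n - valueCount x 2 ≤
      (Finset.univ.filter fun y : Fin n → Fin 3 => x ≤ y ∧ coordSum y = coordSum x + 1).card := by
  rw [← card_filter_ne_two]
  have hs : ∀ a : Fin 3, a ≠ 2 → ((a + 1 : Fin 3) : ℕ) = a + 1 := by decide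
  refine Finset.card_le_card_of_injOn (fun j => Function.update x j (x j + 1)) ?_ ?_
  · intro j hj
    have hj : x j ≠ 2 := by simpa using hj
    simp only [Finset.coe_filter, Finset.mem_univ, true_and, Set.mem_ofPred_eq]
    refine ⟨?_, ?_⟩
    · rw [le_update_iff]
      refine ⟨?_, fun _ _ => le_rfl⟩
      rw [Fin.le_def, hs _ hj]
      omega
    · unfold coordSum
      rw [← Finset.add_sum_erase _ _ (Finset.mem_univ j),
        ← Finset.add_sum_erase _ (fun j => (x j : ℕ)) (Finset.mem_univ j)]
      rw [Finset.sum_congr rfl (g := fun k => (x k : ℕ))]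
      · rw [Function.update_self, hs _ hj]
        omega
      · intro k hk
        rw [Function.update_of_ne (Finset.ne_of_mem_erase hk)]
  · intro j hj k hk hjk
    have hj : x j ≠ 2 := by simpa using hj
    by_contra hne
    have := congrFun hjk j
    simp only [Function.update_self, Function.update_of_ne hne] at this
    have h2 := hs _ hj
    rw [this] at h2
    omega

open Classical in
/-- The number of lower covers of `y` is at most the number of nonzero coordinates. -/
lemma card_lower_covers_le {n : ℕ} (y : Fin n → Fin 3) :
    (Finset.univ.filter fun x : Fin n → Fin 3 => x ≤ y ∧ coordSum y = coordSum x + 1).card ≤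
      n - valueCount y 0 := by
  rw [← card_filter_ne_zero]
  refine Finset.card_le_card_of_surjOn (fun j => Function.update y j (y j - 1)) ?_
  intro x hx
  simp only [Finset.coe_filter, Finset.mem_univ, true_and, Set.mem_ofPred_eq] at hx
  obtain ⟨j, hj, hk⟩ := exists_ne_of_coordSum_succ hx.1 hx.2
  have hp : ∀ a b : Fin 3, (a : ℕ) = b + 1 → a ≠ 0 ∧ a - 1 = b := by decide
  refine ⟨j, by simpa using (hp _ _ hj).1, ?_⟩
  funext k
  by_cases hkj : k = j
  · subst hkj; simp [(hp _ _ hj).2]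
  · simp [hkj, hk k hkj]

lemma valueCount_cover {n : ℕ} {x y : Fin n → Fin 3} (h : x ≤ y) (hr : coordSum y = coordSum x + 1)
    (hx : coordSum x < n) : n - valueCount y 0 ≤ n - valueCount x 2 := by
  obtain ⟨j, hj, hk⟩ := exists_ne_of_coordSum_succ h hr
  have hsub : (Finset.univ.filter fun k => x k = 0) ⊆
      insert j (Finset.univ.filter fun k => y k = 0) := by
    intro k hk'
    by_cases hkj : k = j
    · simp [hkj]
    · simp only [Finset.mem_filter, Finset.mem_univ, true_and] at hk'
      simp [hkj, hk k hkj, hk']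
  have h1 := (Finset.card_le_card hsub).trans (Finset.card_insert_le _ _)
  have h2 := coordSum_eq_valueCount x
  have h3 := valueCount_add x
  unfold valueCount at *
  omega

/-- Consecutive levels below the middle are matched by Hall's theorem. -/
lemma exists_coordSum_succ_injection (n : ℕ) :
    ∃ f : (Fin n → Fin 3) → (Fin n → Fin 3), ∀ x, coordSum x < n →
      x ≤ f x ∧ coordSum (f x) = coordSum x + 1 ∧
        ∀ y, coordSum y = coordSum x → f x = f y → x = y := by
  classical
  let L := {x : Fin n → Fin 3 // coordSum x < n}
  let r : L → (Fin n → Fin 3) → Prop := fun x y => x.1 ≤ y ∧ coordSum y = coordSum x.1 + 1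
  have hall : ∀ S : Finset L, S.card ≤
      (Finset.univ.filter fun y => ∃ x ∈ S, r x y).card := by
    intro S
    set N := Finset.univ.filter fun y => ∃ x ∈ S, r x y
    have hpos : ∀ x : L, 0 < n - valueCount x.1 2 := by
      intro x
      have h2 := coordSum_eq_valueCount x.1
      have h3 := valueCount_add x.1
      have := x.2
      omega
    have key : (S.card : ℚ) ≤ N.card := by
      calc (S.card : ℚ) = ∑ x ∈ S, 1 := by simp
        _ ≤ ∑ x ∈ S, ∑ y ∈ N, if r x y then ((n - valueCount x.1 2 : ℕ) : ℚ)⁻¹ else 0 := by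
          refine Finset.sum_le_sum fun x hx => ?_
          rw [← Finset.sum_filter, Finset.sum_const, nsmul_eq_mul]
          have hN : N.filter (r x) = Finset.univ.filter (r x) := by
            ext y
            simp only [N, Finset.mem_filter, Finset.mem_univ, true_and, and_iff_right_iff_imp]
            exact fun h => ⟨x, hx, h⟩
          rw [hN, ← div_eq_mul_inv, le_div_iff₀ (by exact_mod_cast hpos x), one_mul]
          exact_mod_cast le_card_upper_covers x.1
        _ ≤ ∑ x ∈ S, ∑ y ∈ N, if r x y then ((n - valueCount y 0 : ℕ) : ℚ)⁻¹ else 0 := by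
          refine Finset.sum_le_sum fun x _ => Finset.sum_le_sum fun y _ => ?_
          split_ifs with h
          · have h1 := valueCount_cover h.1 h.2 x.2
            have h0 : 0 < n - valueCount y 0 := by
              refine lt_of_lt_of_le (Finset.card_pos.2 ⟨x.1, ?_⟩) (card_lower_covers_le y)
              simpa using h
            gcongr
          · exact le_rfl
        _ = ∑ y ∈ N, ∑ x ∈ S, if r x y then ((n - valueCount y 0 : ℕ) : ℚ)⁻¹ else 0 :=
          Finset.sum_comm
        _ ≤ ∑ y ∈ N, 1 := by
          refine Finset.sum_le_sum fun y _ => ?_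
          rw [← Finset.sum_filter, Finset.sum_const, nsmul_eq_mul, ← div_eq_mul_inv]
          refine div_le_one_of_le₀ ?_ (by positivity)
          refine Nat.cast_le.2 (le_trans ?_ (card_lower_covers_le y))
          refine Finset.card_le_card_of_injOn Subtype.val ?_ Subtype.val_injective.injOn
          intro x hx
          have hx := (Finset.mem_filter.1 hx).2
          simpa using hx
        _ = N.card := by simp
    exact_mod_cast key
  obtain ⟨g, hg, hr⟩ := (Fintype.all_card_le_filter_rel_iff_exists_injective r).1 hall
  refine ⟨fun x => if h : coordSum x < n then g ⟨x, h⟩ else x, fun x hx => ?_⟩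
  simp only [hx, dif_pos]
  refine ⟨(hr ⟨x, hx⟩).1, (hr ⟨x, hx⟩).2, fun y hy hxy => ?_⟩
  have hy' : coordSum y < n := hy ▸ hx
  simp only [hy', dif_pos] at hxy
  exact congrArg Subtype.val (hg hxy)

/-- The elements of the lower half are partitioned into chains indexed by the middle level. -/
lemma exists_lower_chain_map (n : ℕ) :
    ∃ χ : (Fin n → Fin 3) → (Fin n → Fin 3),
      (∀ x, coordSum x ≤ n → coordSum (χ x) = n ∧ x ≤ χ x) ∧
      ∀ x y, coordSum x ≤ coordSum y → coordSum y ≤ n → χ x = χ y → x ≤ y := by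
  obtain ⟨f, hf⟩ := exists_coordSum_succ_injection n
  have hiter : ∀ k x, coordSum x + k ≤ n →
      coordSum (f^[k] x) = coordSum x + k ∧ x ≤ f^[k] x := by
    intro k
    induction k with
    | zero => intro x _; simp
    | succ k ih =>
      intro x hx
      obtain ⟨h1, h2, -⟩ := hf x (by omega)
      obtain ⟨h3, h4⟩ := ih (f x) (by omega)
      rw [Function.iterate_succ_apply]
      exact ⟨by omega, h1.trans h4⟩
  have hinj : ∀ k x y, coordSum x + k ≤ n → coordSum y = coordSum x →
      f^[k] x = f^[k] y → x = y := by
    intro k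
    induction k with
    | zero => intro x y _ _ h; exact h
    | succ k ih =>
      intro x y hx hy hxy
      obtain ⟨-, h2, h3⟩ := hf x (by omega)
      obtain ⟨-, h5, -⟩ := hf y (by omega)
      rw [Function.iterate_succ_apply, Function.iterate_succ_apply] at hxy
      exact h3 y hy (ih (f x) (f y) (by omega) (by omega) hxy)
  refine ⟨fun x => f^[n - coordSum x] x, fun x hx => ?_, fun x y hxy hy h => ?_⟩
  · have := hiter (n - coordSum x) x (by omega)
    exact ⟨this.1.trans (by omega), this.2⟩
  · obtain ⟨h1, h2⟩ := hiter (coordSum y - coordSum x) x (by omega)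
    have he : n - coordSum x = (n - coordSum y) + (coordSum y - coordSum x) := by omega
    simp only [he, Function.iterate_add_apply] at h
    rwa [hinj (n - coordSum y) _ y (by omega) (by omega) h] at h2

/-- The poset `{0,1,2}^n` is partitioned into chains indexed by the middle level. -/
lemma exists_chain_map (n : ℕ) :
    ∃ χ : (Fin n → Fin 3) → (Fin n → Fin 3), (∀ x, coordSum (χ x) = n) ∧
      ∀ x y, coordSum x ≤ coordSum y → χ x = χ y → x ≤ y := by
  obtain ⟨χ, h1, h2⟩ := exists_lower_chain_map n
  have hup : ∀ x : Fin n → Fin 3, ¬ coordSum x ≤ n →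
      coordSum (reflect (χ (reflect x))) = n ∧ reflect (χ (reflect x)) ≤ x := by
    intro x hx
    have := coordSum_reflect x
    obtain ⟨h3, h4⟩ := h1 (reflect x) (by omega)
    have := coordSum_reflect (χ (reflect x))
    refine ⟨by omega, ?_⟩
    rwa [← reflect_le_reflect, reflect_reflect]
  refine ⟨fun x => if coordSum x ≤ n then χ x else reflect (χ (reflect x)),
    fun x => ?_, fun x y hxy h => ?_⟩
  · dsimp only
    split_ifs with hx
    · exact (h1 x hx).1
    · exact (hup x hx).1
  · dsimp only at h
    by_cases hx : coordSum x ≤ n <;> by_cases hy : coordSum y ≤ n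
    · rw [if_pos hx, if_pos hy] at h
      exact h2 x y hxy hy h
    · rw [if_pos hx, if_neg hy] at h
      exact ((h1 x hx).2.trans_eq h).trans (hup y hy).2
    · omega
    · rw [if_neg hx, if_neg hy] at h
      have h' := congrArg reflect h
      rw [reflect_reflect, reflect_reflect] at h'
      have := coordSum_reflect x
      have := coordSum_reflect y
      rw [← reflect_le_reflect]
      exact h2 _ _ (by omega) (by omega) h'.symm

lemma card_filter_coordSum (n i : ℕ) :
    (Finset.univ.filter fun x : Fin n → Fin 3 => coordSum x = i).card = ell n i := by
  unfold ell coordSum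
  rw [Nat.card_eq_fintype_card, Fintype.card_subtype]

lemma three_pow_le (n : ℕ) : 3 ^ n ≤ (2 * n + 1) * ell n n := by
  obtain ⟨χ, h1, h2⟩ := exists_chain_map n
  rw [← card_filter_coordSum n n]
  have := Finset.card_le_card_of_injOn (s := Finset.univ)
    (t := Finset.range (2 * n + 1) ×ˢ Finset.univ.filter fun x : Fin n → Fin 3 => coordSum x = n)
    (fun x => (coordSum x, χ x)) ?_ ?_
  · simpa using this
  · intro x _
    simp [h1, Nat.lt_succ_of_le (coordSum_le x)]
  · intro x _ y _ hxy
    simp only [Prod.mk.injEq] at hxy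
    exact eq_of_le_of_coordSum_eq (h2 x y hxy.1.le hxy.2) hxy.1

open Classical in
/-- A random automorphism puts `x` and `y` on a common chain with probability at most `1 / Q` when
`y` has at least `Q` images under the stabilizer of `x`. -/
lemma mul_card_common_chain_le {n : ℕ} {χ : (Fin n → Fin 3) → (Fin n → Fin 3)}
    (hχ : ∀ x y, coordSum x ≤ coordSum y → χ x = χ y → x ≤ y) (x y : Fin n → Fin 3)
    (Y : Finset (Fin n → Fin 3))
    (hY : ∀ z ∈ Y, ∃ τ : Equiv.Perm (Fin n), x ∘ τ = x ∧ y ∘ τ = z) :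
    Y.card * (Finset.univ.filter fun σ : Equiv.Perm (Fin n) => χ (x ∘ σ) = χ (y ∘ σ)).card ≤
      n.factorial := by
  choose! τ hτ using hY
  rw [← Finset.card_product]
  have := Finset.card_le_card_of_injOn
    (s := Y ×ˢ Finset.univ.filter fun σ : Equiv.Perm (Fin n) => χ (x ∘ σ) = χ (y ∘ σ))
    (t := (Finset.univ : Finset (Equiv.Perm (Fin n))))
    (fun a => (τ a.1)⁻¹ * a.2) (by simp [Set.MapsTo]) ?_
  · simpa [Fintype.card_perm] using this
  rintro ⟨z, σ⟩ hz ⟨w, ρ⟩ hw h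
  simp only [Finset.coe_product, Set.mem_prod, Finset.mem_coe, Finset.mem_filter,
    Finset.mem_univ, true_and] at hz hw
  set π : Equiv.Perm (Fin n) := (τ z)⁻¹ * σ with hπ
  have hw' : π = (τ w)⁻¹ * ρ := h
  have hσ : σ = τ z * π := by simp [hπ]
  have hρ : ρ = τ w * π := by simp [hw']
  have hzx : x ∘ σ = x ∘ π := by
    rw [hσ, Equiv.Perm.coe_mul, ← Function.comp_assoc, (hτ z hz.1).1]
  have hwx : x ∘ ρ = x ∘ π := by
    rw [hρ, Equiv.Perm.coe_mul, ← Function.comp_assoc, (hτ w hw.1).1]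
  have hzy : y ∘ σ = z ∘ π := by
    rw [hσ, Equiv.Perm.coe_mul, ← Function.comp_assoc, (hτ z hz.1).2]
  have hwy : y ∘ ρ = w ∘ π := by
    rw [hρ, Equiv.Perm.coe_mul, ← Function.comp_assoc, (hτ w hw.1).2]
  have hs : coordSum (z ∘ π) = coordSum (w ∘ π) := by
    rw [← hzy, ← hwy, coordSum_comp_perm, coordSum_comp_perm]
  have hc : χ (z ∘ π) = χ (w ∘ π) := by
    rw [← hzy, ← hwy, ← hz.2, ← hw.2, hzx, hwx]
  have hzw : z = w := by
    have := eq_of_le_of_coordSum_eq (hχ _ _ hs.le hc) hs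
    funext j
    simpa using congrFun this (π⁻¹ j)
  subst hzw
  rw [hσ, hρ]

open Classical in
lemma card_filter_no_far_chain_le {n : ℕ} {χ : (Fin n → Fin 3) → (Fin n → Fin 3)}
    (hm : ∀ x, coordSum (χ x) = n)
    (hχ : ∀ x y, coordSum x ≤ coordSum y → χ x = χ y → x ≤ y) (F : Finset (Fin n → Fin 3))
    (D : ℕ) (hD : 0 < D) (σ : Equiv.Perm (Fin n)) :
    (F.filter fun x => ¬ ∃ y ∈ F, coordSum x + D ≤ coordSum y ∧ χ (x ∘ σ) = χ (y ∘ σ)).card ≤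
      D * ell n n := by
  rw [← card_filter_coordSum n n]
  have := Finset.card_le_card_of_injOn
    (s := F.filter fun x => ¬ ∃ y ∈ F, coordSum x + D ≤ coordSum y ∧ χ (x ∘ σ) = χ (y ∘ σ))
    (t := Finset.range D ×ˢ Finset.univ.filter fun x : Fin n → Fin 3 => coordSum x = n)
    (fun x => (coordSum x % D, χ (x ∘ σ))) ?_ ?_
  · simpa using this
  · intro x _
    simp [hm, Nat.mod_lt _ hD]
  · have key : ∀ x ∈ F, ∀ y ∈ F,
        (¬ ∃ z ∈ F, coordSum x + D ≤ coordSum z ∧ χ (x ∘ σ) = χ (z ∘ σ)) →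
        coordSum x % D = coordSum y % D → χ (x ∘ σ) = χ (y ∘ σ) → coordSum x ≤ coordSum y →
        x = y := by
      intro x _ y hy hxn hmod hc hle
      push Not at hxn
      have hlt : coordSum y < coordSum x + D := by
        by_contra! h
        exact hxn y hy h hc
      have he : coordSum x = coordSum y := by
        have hd : D ∣ coordSum y - coordSum x :=
          (Nat.modEq_iff_dvd' hle).1 hmod
        have := Nat.eq_zero_of_dvd_of_lt hd (by omega)
        omega
      have hs : coordSum (x ∘ σ) = coordSum (y ∘ σ) := by
        rwa [coordSum_comp_perm, coordSum_comp_perm]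
      have := eq_of_le_of_coordSum_eq (hχ _ _ hs.le hc) hs
      funext j
      simpa using congrFun this (σ⁻¹ j)
    intro x hx y hy hxy
    simp only [Finset.coe_filter, Set.mem_ofPred_eq] at hx hy
    simp only [Prod.mk.injEq] at hxy
    rcases le_total (coordSum x) (coordSum y) with h | h
    · exact key x hx.1 y hy.1 hx.2 hxy.1 hxy.2 h
    · exact (key y hy.1 x hx.1 hy.2 hxy.1.symm hxy.2.symm h).symm

open Classical in
/-- Supersaturation: a large family contains an element below many others. -/
lemma exists_card_above_ge {n : ℕ} (F : Finset (Fin n → Fin 3)) (hF : F.Nonempty) (D Q : ℕ)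
    (hD : 0 < D)
    (hQ : ∀ x ∈ F, ∀ y ∈ F, x ≤ y → coordSum x + D ≤ coordSum y →
      ∃ Y : Finset (Fin n → Fin 3), Q ≤ Y.card ∧
        ∀ z ∈ Y, ∃ τ : Equiv.Perm (Fin n), x ∘ τ = x ∧ y ∘ τ = z) :
    ∃ x ∈ F, F.card * Q ≤ D * ell n n * Q + F.card * (F.filter fun y => x < y).card := by
  obtain ⟨χ, hm, hχ⟩ := exists_chain_map n
  obtain ⟨x₀, hx₀, hmax⟩ := Finset.exists_max_image F (fun x => (F.filter fun y => x < y).card) hF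
  refine ⟨x₀, hx₀, ?_⟩
  set d := (F.filter fun y => x₀ < y).card
  let P : (Fin n → Fin 3) → (Fin n → Fin 3) → Equiv.Perm (Fin n) → Prop :=
    fun x y σ => coordSum x + D ≤ coordSum y ∧ χ (x ∘ σ) = χ (y ∘ σ)
  have hlt : ∀ x y σ, P x y σ → x < y := by
    intro x y σ h
    have hle := hχ (x ∘ σ) (y ∘ σ) (by
      rw [coordSum_comp_perm, coordSum_comp_perm]; have := h.1; omega) h.2
    have hxy : x ≤ y := fun j => by simpa using hle (σ⁻¹ j)
    refine lt_of_le_of_ne hxy fun e => ?_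
    have := h.1
    rw [e] at this
    omega
  have hpair : ∀ x ∈ F, ∀ y ∈ F, Q * (Finset.univ.filter fun σ => P x y σ).card ≤
      if x < y then n.factorial else 0 := by
    intro x hx y hy
    by_cases h : ∃ σ, P x y σ
    · obtain ⟨σ, hσ⟩ := h
      have hxy := hlt x y σ hσ
      rw [if_pos hxy]
      obtain ⟨Y, hYc, hY⟩ := hQ x hx y hy hxy.le hσ.1
      refine le_trans (Nat.mul_le_mul hYc (Finset.card_le_card ?_))
        (mul_card_common_chain_le hχ x y Y hY)
      exact Finset.monotone_filter_right _ fun σ _ h => h.2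
    · push Not at h
      simp [h]
  have hσ : ∀ σ : Equiv.Perm (Fin n),
      F.card ≤ D * ell n n + ∑ x ∈ F, ∑ y ∈ F, if P x y σ then 1 else 0 := by
    intro σ
    rw [← Finset.card_filter_add_card_filter_not (s := F) (fun x => ∃ y ∈ F, P x y σ), add_comm]
    refine add_le_add (card_filter_no_far_chain_le hm hχ F D hD σ) ?_
    rw [Finset.card_filter]
    refine Finset.sum_le_sum fun x _ => ?_
    split_ifs with h
    · obtain ⟨y, hy, hP⟩ := h
      refine le_trans (by rw [if_pos hP])
        (Finset.single_le_sum (f := fun y => if P x y σ then 1 else 0) (fun _ _ => by positivity)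
          hy)
    · exact Nat.zero_le _
  have hsum : n.factorial * F.card ≤ n.factorial * (D * ell n n) +
      ∑ x ∈ F, ∑ y ∈ F, (Finset.univ.filter fun σ => P x y σ).card := by
    have := Finset.sum_le_sum fun σ (_ : σ ∈ (Finset.univ : Finset (Equiv.Perm (Fin n)))) => hσ σ
    simp only [Finset.sum_add_distrib, Finset.sum_const, Finset.card_univ, Fintype.card_perm,
      Fintype.card_fin, smul_eq_mul] at this
    rw [Finset.sum_comm] at this
    simp only [Finset.card_filter]
    refine this.trans_eq ?_
    congr 1
    exact Finset.sum_congr rfl fun x _ => Finset.sum_comm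
  have hfinal : n.factorial * (F.card * Q) ≤
      n.factorial * (D * ell n n * Q + F.card * d) := by
    calc n.factorial * (F.card * Q) = (n.factorial * F.card) * Q := by ring
      _ ≤ (n.factorial * (D * ell n n) +
          ∑ x ∈ F, ∑ y ∈ F, (Finset.univ.filter fun σ => P x y σ).card) * Q :=
        Nat.mul_le_mul_right _ hsum
      _ = n.factorial * (D * ell n n) * Q +
          ∑ x ∈ F, ∑ y ∈ F, Q * (Finset.univ.filter fun σ => P x y σ).card := by
        rw [add_mul, mul_comm (∑ x ∈ F, _) Q, Finset.mul_sum]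
        simp only [Finset.mul_sum]
      _ ≤ n.factorial * (D * ell n n) * Q +
          ∑ x ∈ F, ∑ y ∈ F, if x < y then n.factorial else 0 := by
        gcongr with x hx y hy
        exact hpair x hx y hy
      _ ≤ n.factorial * (D * ell n n) * Q + ∑ x ∈ F, d * n.factorial := by
        gcongr with x hx
        rw [← Finset.sum_filter, Finset.sum_const, smul_eq_mul]
        exact Nat.mul_le_mul_right _ (hmax x hx)
      _ = n.factorial * (D * ell n n * Q + F.card * d) := by
        rw [Finset.sum_const, smul_eq_mul]; ring
  exact Nat.le_of_mul_le_mul_left hfinal (Nat.factorial_pos n)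

/-- Each value occurs with frequency at least `3 / 10` in `x`. -/
def IsBalanced {n : ℕ} (x : Fin n → Fin 3) : Prop := ∀ v, 3 * n ≤ 10 * valueCount x v

lemma card_filter_ne_le {n : ℕ} {x y : Fin n → Fin 3} (h : x ≤ y) :
    (Finset.univ.filter fun j => x j ≠ y j).card + coordSum x ≤ coordSum y := by
  unfold coordSum
  rw [Finset.card_filter, ← Finset.sum_add_distrib]
  refine Finset.sum_le_sum fun j _ => ?_
  have hj : (x j : ℕ) ≤ y j := h j
  split_ifs with hne
  · have : (x j : ℕ) ≠ y j := fun e => hne (Fin.ext e)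
    omega
  · omega

lemma le_two_mul_card_filter_ne {n : ℕ} (x y : Fin n → Fin 3) :
    coordSum y ≤ coordSum x + 2 * (Finset.univ.filter fun j => x j ≠ y j).card := by
  unfold coordSum
  rw [Finset.card_filter, Finset.mul_sum, ← Finset.sum_add_distrib]
  refine Finset.sum_le_sum fun j _ => ?_
  have := (y j).2
  split_ifs with hne
  · omega
  · rw [not_not.1 hne]; omega

lemma le_card_filter_both_eq {n : ℕ} {x y : Fin n → Fin 3} (hx : IsBalanced x)
    (hy : IsBalanced y) (h : x ≤ y) (v : Fin 3) :
    n ≤ 10 * (Finset.univ.filter fun j => x j = v ∧ y j = v).card := by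
  have h1 := card_filter_ne_le h
  have h2 := coordSum_eq_valueCount x
  have h3 := coordSum_eq_valueCount y
  have h4 := valueCount_add x
  have h5 := valueCount_add y
  have hsub : (Finset.univ.filter fun j => x j = v) ⊆
      (Finset.univ.filter fun j => x j = v ∧ y j = v) ∪
        (Finset.univ.filter fun j => x j ≠ y j) := by
    intro j hj
    simp only [Finset.mem_filter, Finset.mem_univ, true_and, Finset.mem_union] at hj ⊢
    by_cases hxy : x j = y j
    · exact Or.inl ⟨hj, hxy ▸ hj⟩
    · exact Or.inr hxy
  have h6 := (Finset.card_le_card hsub).trans (Finset.card_union_le _ _)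
  have h7 := hx v
  have := hx 0
  have := hx 1
  have := hx 2
  have := hy 0
  have := hy 1
  have := hy 2
  change valueCount x v ≤ _ at h6
  omega

/-- Swapping `s` raised coordinates with `s` unraised ones of the same value. -/
lemma exists_perm_swap {n s : ℕ} {x y : Fin n → Fin 3} {v : Fin 3} (J U : Finset (Fin n))
    (hJ : J.card = s) (hU : U.card = s) (hJv : ∀ j ∈ J, x j = v ∧ y j ≠ v)
    (hUv : ∀ j ∈ U, x j = v ∧ y j = v) :
    ∃ τ : Equiv.Perm (Fin n), x ∘ τ = x ∧
      ∀ j, x j = v → y j = v → (y (τ j) ≠ v ↔ j ∈ U) := by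
  let a := J.orderEmbOfFin hJ
  let b := U.orderEmbOfFin hU
  have ha : ∀ i, a i ∈ J := J.orderEmbOfFin_mem hJ
  have hb : ∀ i, b i ∈ U := U.orderEmbOfFin_mem hU
  let e : Fin s ⊕ Fin s ↪ Fin n := ⟨Sum.elim a b, a.injective.sumElim b.injective
    fun i k h => (hJv _ (ha i)).2 (h ▸ (hUv _ (hb k)).2)⟩
  let τ := Equiv.Perm.viaFintypeEmbedding (Equiv.sumComm (Fin s) (Fin s)) e
  have hτa : ∀ i, τ (a i) = b i := fun i =>
    Equiv.Perm.viaFintypeEmbedding_apply_image (Equiv.sumComm (Fin s) (Fin s)) e (Sum.inl i)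
  have hτb : ∀ i, τ (b i) = a i := fun i =>
    Equiv.Perm.viaFintypeEmbedding_apply_image (Equiv.sumComm (Fin s) (Fin s)) e (Sum.inr i)
  have hτ : ∀ j, (∀ i, a i ≠ j) → (∀ i, b i ≠ j) → τ j = j := by
    intro j h1 h2
    refine Equiv.Perm.viaFintypeEmbedding_apply_notMem_range _ e ?_
    rintro ⟨i | i, hi⟩
    · exact h1 i hi
    · exact h2 i hi
  refine ⟨τ, ?_, fun j hxj hyj => ?_⟩
  · funext j
    by_cases h1 : ∃ i, a i = j
    · obtain ⟨i, rfl⟩ := h1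
      rw [Function.comp_apply, hτa, (hJv _ (ha i)).1, (hUv _ (hb i)).1]
    by_cases h2 : ∃ i, b i = j
    · obtain ⟨i, rfl⟩ := h2
      rw [Function.comp_apply, hτb, (hJv _ (ha i)).1, (hUv _ (hb i)).1]
    · push Not at h1 h2
      rw [Function.comp_apply, hτ j h1 h2]
  · by_cases h2 : ∃ i, b i = j
    · obtain ⟨i, rfl⟩ := h2
      rw [hτb]
      exact iff_of_true (hJv _ (ha i)).2 (hb i)
    · push Not at h2
      rw [hτ j (fun i hi => (hJv _ (ha i)).2 (hi ▸ hyj)) h2]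
      refine iff_of_false (fun h => h hyj) fun hj => ?_
      have : j ∈ Set.range b := by rw [U.range_orderEmbOfFin hU]; exact hj
      exact this.elim h2

open Classical in
lemma exists_orbit_card_ge {n s : ℕ} {x y : Fin n → Fin 3} {v : Fin 3}
    (hs : s ≤ (Finset.univ.filter fun j => x j = v ∧ y j ≠ v).card) :
    ∃ Y : Finset (Fin n → Fin 3),
      (Finset.univ.filter fun j => x j = v ∧ y j = v).card.choose s ≤ Y.card ∧
        ∀ z ∈ Y, ∃ τ : Equiv.Perm (Fin n), x ∘ τ = x ∧ y ∘ τ = z := by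
  obtain ⟨J, hJsub, hJ⟩ := Finset.exists_subset_card_eq hs
  set R := Finset.univ.filter fun j => x j = v ∧ y j = v with hR
  have hτ : ∀ U ∈ R.powersetCard s, ∃ τ : Equiv.Perm (Fin n), x ∘ τ = x ∧
      ∀ j, x j = v → y j = v → (y (τ j) ≠ v ↔ j ∈ U) := by
    intro U hU
    rw [Finset.mem_powersetCard] at hU
    refine exists_perm_swap J U hJ hU.2 (fun j hj => ?_) (fun j hj => ?_)
    · simpa using hJsub hj
    · simpa [hR] using hU.1 hj
  choose! τ hτ using hτ
  refine ⟨(R.powersetCard s).image fun U => y ∘ τ U, ?_, ?_⟩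
  · rw [Finset.card_image_of_injOn, Finset.card_powersetCard]
    intro U hU W hW hUW
    have hU' := (Finset.mem_powersetCard.1 hU).1
    have hW' := (Finset.mem_powersetCard.1 hW).1
    have hiff : ∀ j ∈ R, (j ∈ U ↔ j ∈ W) := by
      intro j hj
      have hj' : x j = v ∧ y j = v := by simpa [hR] using hj
      rw [← (hτ U hU).2 j hj'.1 hj'.2, ← (hτ W hW).2 j hj'.1 hj'.2]
      have := congrFun hUW j
      simp only [Function.comp_apply] at this
      rw [this]
    ext j
    exact ⟨fun h => (hiff j (hU' h)).1 h, fun h => (hiff j (hW' h)).2 h⟩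
  · intro z hz
    obtain ⟨U, hU, rfl⟩ := Finset.mem_image.1 hz
    exact ⟨τ U, (hτ U hU).1, rfl⟩

/-- If the levels of `x < y` differ by at least `4 * s - 3` then at least `s` coordinates with the
same value are raised. -/
lemma exists_value_raised {n s : ℕ} {x y : Fin n → Fin 3} (h : x ≤ y)
    (hs : coordSum x + (4 * s - 3) ≤ coordSum y) :
    ∃ v, s ≤ (Finset.univ.filter fun j => x j = v ∧ y j ≠ v).card := by
  by_contra! hc
  have h1 := le_two_mul_card_filter_ne x y
  have hsub : (Finset.univ.filter fun j => x j ≠ y j) ⊆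
      (Finset.univ.filter fun j => x j = 0 ∧ y j ≠ 0) ∪
        (Finset.univ.filter fun j => x j = 1 ∧ y j ≠ 1) := by
    intro j hj
    have hval : ∀ a b : Fin 3, a ≤ b → a ≠ b → a = 0 ∧ b ≠ 0 ∨ a = 1 ∧ b ≠ 1 := by decide
    simp only [Finset.mem_filter, Finset.mem_univ, true_and, Finset.mem_union] at hj ⊢
    exact hval _ _ (h j) hj
  have h2 := (Finset.card_le_card hsub).trans (Finset.card_union_le _ _)
  have := hc 0
  have := hc 1
  omega

open Classical in
/-- Supersaturation for families of balanced elements. -/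
lemma exists_card_above_ge_of_isBalanced {n : ℕ} (F : Finset (Fin n → Fin 3)) (hF : F.Nonempty)
    (hb : ∀ x ∈ F, IsBalanced x) (s Q : ℕ) (hs : 0 < s)
    (hQ : ∀ k, n ≤ 10 * k → Q ≤ k.choose s) :
    ∃ x ∈ F, F.card * Q ≤
      (4 * s - 3) * ell n n * Q + F.card * (F.filter fun y => x < y).card := by
  refine exists_card_above_ge F hF (4 * s - 3) Q (by omega) fun x hx y hy hxy hlt => ?_
  obtain ⟨v, hv⟩ := exists_value_raised hxy hlt
  obtain ⟨Y, hY, hτ⟩ := exists_orbit_card_ge hv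
  exact ⟨Y, (hQ _ (le_card_filter_both_eq (hb x hx) (hb y hy) hxy v)).trans hY, hτ⟩

lemma card_filter_valueCount_lt_mul_le {n : ℕ} (v : Fin 3) (u : ℝ) (hu : 0 < u) (hu1 : u ≤ 1) :
    ((Finset.univ.filter fun x : Fin n → Fin 3 => 10 * valueCount x v < 3 * n).card : ℝ) *
      (u ^ 3) ^ n ≤ (u ^ 10 + 2) ^ n := by
  have hprod : ∀ x : Fin n → Fin 3,
      ∏ j, (if x j = v then u ^ 10 else 1) = u ^ (10 * valueCount x v) := by
    intro x
    rw [Finset.prod_ite]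
    simp [valueCount, pow_mul]
  have hsum : ∑ x : Fin n → Fin 3, u ^ (10 * valueCount x v) = (u ^ 10 + 2) ^ n := by
    have h := Finset.prod_univ_sum (fun _ : Fin n => (Finset.univ : Finset (Fin 3)))
      (fun _ a => if a = v then u ^ 10 else 1)
    rw [Fintype.piFinset_univ] at h
    rw [← Finset.sum_congr rfl fun x _ => hprod x, ← h, Finset.prod_const, Finset.card_univ,
      Fintype.card_fin]
    congr 1
    fin_cases v <;> simp [Fin.sum_univ_three] <;> ring
  rw [← hsum, ← nsmul_eq_mul, ← Finset.sum_const]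
  refine (Finset.sum_le_sum fun x hx => ?_).trans
    (Finset.sum_le_sum_of_subset_of_nonneg (Finset.filter_subset _ _) fun _ _ _ => by positivity)
  rw [← pow_mul]
  exact pow_le_pow_of_le_one hu.le hu1 (Finset.mem_filter.1 hx).2.le

open Classical in
lemma card_filter_not_isBalanced_le (n : ℕ) :
    ((Finset.univ.filter fun x : Fin n → Fin 3 => ¬ IsBalanced x).card : ℝ) ≤
      3 * (999 / 1000 : ℝ) ^ n * 3 ^ n := by
  have hv : ∀ v : Fin 3,
      ((Finset.univ.filter fun x : Fin n → Fin 3 => 10 * valueCount x v < 3 * n).card : ℝ) ≤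
        (999 / 1000 : ℝ) ^ n * 3 ^ n := by
    intro v
    have h := card_filter_valueCount_lt_mul_le (n := n) v (49 / 50) (by norm_num) (by norm_num)
    refine le_of_mul_le_mul_right (h.trans ?_) (by positivity : (0 : ℝ) < ((49 / 50) ^ 3) ^ n)
    rw [← mul_pow, ← mul_pow]
    refine pow_le_pow_left₀ (by positivity) (by norm_num) _
  have hsub : (Finset.univ.filter fun x : Fin n → Fin 3 => ¬ IsBalanced x) ⊆
      Finset.univ.biUnion fun v : Fin 3 =>
        Finset.univ.filter fun x : Fin n → Fin 3 => 10 * valueCount x v < 3 * n := by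
    intro x hx
    simpa [IsBalanced] using hx
  calc _ ≤ ((Finset.univ.biUnion fun v : Fin 3 => Finset.univ.filter
        fun x : Fin n → Fin 3 => 10 * valueCount x v < 3 * n).card : ℝ) :=
      Nat.cast_le.2 (Finset.card_le_card hsub)
    _ ≤ ∑ v : Fin 3, ((Finset.univ.filter
        fun x : Fin n → Fin 3 => 10 * valueCount x v < 3 * n).card : ℝ) := by
      exact_mod_cast Finset.card_biUnion_le
    _ ≤ ∑ _v : Fin 3, (999 / 1000 : ℝ) ^ n * 3 ^ n := Finset.sum_le_sum fun v _ => hv v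
    _ = _ := by simp; ring

open Classical in
/-- Weights on finsets dominating the exponential moment of the size of an antichain, obtained by
repeatedly branching on whether an element with many elements above it is chosen. -/
lemma exists_antichain_weights {α : Type*} [PartialOrder α] (p l : ℝ) (hp : 0 ≤ p)
    (hl : 0 ≤ l) (b : ℕ → ℝ) (hb : ∀ F : Finset α,
      (1 + p * (Real.exp l - 1)) ^ F.card ≤ b F.card ∨
      ∃ v ∈ F, b (F.card - 1) + p * Real.exp l * b (F.card - 1 - (F.filter fun y => v < y).card) ≤
        b F.card) (F : Finset α) :
    ∃ c : Finset α → ℝ, (∀ U, 0 ≤ c U) ∧ (∀ U, ¬ U ⊆ F → c U = 0) ∧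
      (∀ I ⊆ F, IsAntichain (· ≤ ·) (I : Set α) →
        Real.exp l ^ I.card ≤ ∑ U ∈ I.powerset, c U) ∧
      ∑ U ∈ F.powerset, c U * p ^ U.card ≤ b F.card := by
  have hl1 : 0 ≤ Real.exp l - 1 := sub_nonneg.2 (Real.one_le_exp hl)
  induction F using Finset.strongInduction with
  | H F ih =>
  rcases hb F with hbase | ⟨v, hv, hstep⟩
  · refine ⟨fun U => if U ⊆ F then (Real.exp l - 1) ^ U.card else 0, fun U => ?_, fun U hU => ?_,
      fun I hI _ => ?_, ?_⟩
    · dsimp only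
      split_ifs <;> positivity
    · simp [hU]
    · have h := Finset.sum_pow_mul_eq_add_pow (Real.exp l - 1) 1 I
      simp only [one_pow, mul_one, sub_add_cancel] at h
      rw [← h]
      refine (Finset.sum_congr rfl fun U hU => ?_).le
      exact (if_pos ((Finset.mem_powerset.1 hU).trans hI)).symm
    · refine le_trans (le_of_eq ?_) hbase
      rw [add_comm, ← Finset.sum_pow_mul_eq_add_pow]
      refine Finset.sum_congr rfl fun U hU => ?_
      dsimp only
      rw [if_pos (Finset.mem_powerset.1 hU), one_pow, mul_one, ← mul_pow, mul_comm]
  · set G := F.erase v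
    set H := G.filter fun y => ¬ v < y
    have hGF : G ⊂ F := Finset.erase_ssubset hv
    have hHG : H ⊆ G := Finset.filter_subset _ _
    have hvG : v ∉ G := Finset.notMem_erase v F
    have hGc : G.card = F.card - 1 := Finset.card_erase_of_mem hv
    have hHc : H.card = F.card - 1 - (F.filter fun y => v < y).card := by
      have h1 := Finset.card_filter_add_card_filter_not (s := G) (fun y => v < y)
      have h2 : G.filter (fun y => v < y) = F.filter fun y => v < y := by
        ext y
        simp only [G, Finset.mem_filter, Finset.mem_erase]
        exact ⟨fun h => ⟨h.1.2, h.2⟩, fun h => ⟨⟨h.2.ne', h.1⟩, h.2⟩⟩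
      rw [h2] at h1
      change _ + H.card = _ at h1
      omega
    obtain ⟨c, hc0, hcs, hc, hcsum⟩ := ih G hGF
    obtain ⟨e, he0, hes, he, hesum⟩ := ih H (lt_of_le_of_lt hHG hGF)
    have hF : F = insert v G := (Finset.insert_erase hv).symm
    refine ⟨fun U => c U + if v ∈ U then Real.exp l * e (U.erase v) else 0, fun U => ?_,
      fun U hU => ?_, fun I hI hanti => ?_, ?_⟩
    · have := hc0 U
      have := he0 (U.erase v)
      dsimp only
      split_ifs <;> positivity
    · have h1 : c U = 0 := hcs U fun h => hU (h.trans hGF.1)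
      simp only [h1, zero_add, ite_eq_right_iff]
      intro hvU
      rw [hes, mul_zero]
      intro h
      refine hU ?_
      rw [← Finset.insert_erase hvU, hF]
      exact Finset.insert_subset_insert v (h.trans hHG)
    · by_cases hvI : v ∈ I
      · have hIH : I.erase v ⊆ H := by
          intro y hy
          obtain ⟨hyv, hyI⟩ := Finset.mem_erase.1 hy
          refine Finset.mem_filter.2 ⟨Finset.mem_erase.2 ⟨hyv, hI hyI⟩, fun hlt => ?_⟩
          exact hanti hvI hyI hyv.symm hlt.le
        have h1 := he _ hIH (hanti.subset (by simp))
        have h2 : I = insert v (I.erase v) := (Finset.insert_erase hvI).symm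
        have h3 : v ∉ I.erase v := Finset.notMem_erase v I
        generalize hJ : I.erase v = J at *
        rw [h2, Finset.card_insert_of_notMem h3, pow_succ, Finset.sum_powerset_insert h3]
        refine le_add_of_nonneg_of_le (Finset.sum_nonneg fun U hU => ?_) ?_
        · have := hc0 U
          have := he0 (U.erase v)
          split_ifs <;> positivity
        · rw [mul_comm]
          refine (mul_le_mul_of_nonneg_left h1 (Real.exp_pos l).le).trans ?_
          rw [Finset.mul_sum]
          refine Finset.sum_le_sum fun U hU => ?_
          have hvU : v ∉ U := fun h => h3 (Finset.mem_powerset.1 hU h)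
          rw [if_pos (Finset.mem_insert_self v U), Finset.erase_insert hvU]
          exact le_add_of_nonneg_left (hc0 _)
      · refine (hc I (fun y hy => Finset.mem_erase.2 ⟨fun h => hvI (h ▸ hy), hI hy⟩) hanti).trans ?_
        refine Finset.sum_le_sum fun U _ => le_add_of_nonneg_right ?_
        have := he0 (U.erase v)
        split_ifs <;> positivity
    · refine le_trans ?_ hstep
      rw [← hHc, ← hGc]
      have hsubset : ∑ U ∈ G.powerset, e U * p ^ U.card = ∑ U ∈ H.powerset, e U * p ^ U.card := by
        symm
        refine Finset.sum_subset (Finset.powerset_mono.2 hHG) fun U _ hU => ?_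
        rw [hes U (fun h => hU (Finset.mem_powerset.2 h)), zero_mul]
      rw [hF, Finset.sum_powerset_insert hvG]
      have h1 : ∑ U ∈ G.powerset,
          (c U + if v ∈ U then Real.exp l * e (U.erase v) else 0) * p ^ U.card ≤ b G.card := by
        refine le_trans (le_of_eq (Finset.sum_congr rfl fun U hU => ?_)) hcsum
        rw [if_neg fun h => hvG (Finset.mem_powerset.1 hU h), add_zero]
      have h2 : ∑ U ∈ G.powerset, (c (insert v U) +
          if v ∈ insert v U then Real.exp l * e ((insert v U).erase v) else 0) *
            p ^ (insert v U).card ≤ p * Real.exp l * b H.card := by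
        refine le_trans (le_of_eq ?_)
          (mul_le_mul_of_nonneg_left (hsubset.trans_le hesum) (by positivity))
        rw [Finset.mul_sum]
        refine Finset.sum_congr rfl fun U hU => ?_
        have hvU : v ∉ U := fun h => hvG (Finset.mem_powerset.1 hU h)
        rw [hcs _ fun h => hvG (h (Finset.mem_insert_self v U)),
          if_pos (Finset.mem_insert_self v U), Finset.erase_insert hvU,
          Finset.card_insert_of_notMem hvU, pow_succ]
        ring
      exact add_le_add h1 h2

open Classical in
/-- Markov's inequality for a weighted count of the finsets contained in a `p`-random set. -/
lemma measure_exists_antichain_le {α Ω : Type*} [PartialOrder α] [Fintype α] [MeasurableSpace Ω]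
    (μ : Measure Ω) (A : Ω → Set α) (p : ℝ) (hp : 0 ≤ p)
    (hind : iIndepSet (fun x => {ω | x ∈ A ω}) μ)
    (hA : ∀ x, μ {ω | x ∈ A ω} = ENNReal.ofReal p)
    (l t B : ℝ) (hl : 0 ≤ l) (c : Finset α → ℝ) (hc0 : ∀ U, 0 ≤ c U)
    (hc : ∀ I : Finset α, IsAntichain (· ≤ ·) (I : Set α) →
      Real.exp l ^ I.card ≤ ∑ U ∈ I.powerset, c U)
    (hB : ∑ U, c U * p ^ U.card ≤ B) :
    μ {ω | ∃ I : Finset α, (I : Set α) ⊆ A ω ∧ IsAntichain (· ≤ ·) (I : Set α) ∧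
      t < I.card} ≤ ENNReal.ofReal (Real.exp (-(l * t)) * B) := by
  let S : Finset α → Set Ω := fun U => toMeasurable μ (⋂ x ∈ U, {ω | x ∈ A ω})
  have hS : ∀ U, MeasurableSet (S U) := fun U => measurableSet_toMeasurable _ _
  have hμS : ∀ U, μ (S U) = ENNReal.ofReal (p ^ U.card) := by
    intro U
    rw [measure_toMeasurable, hind.meas_biInter U, Finset.prod_congr rfl fun x _ => hA x,
      Finset.prod_const, ENNReal.ofReal_pow hp]
  let f : Ω → ENNReal := fun ω =>
    ∑ U, (S U).indicator (fun _ => ENNReal.ofReal (c U)) ω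
  have hf : Measurable f := Finset.measurable_sum _ fun U _ => measurable_const.indicator (hS U)
  have hint : ∫⁻ ω, f ω ∂μ = ENNReal.ofReal (∑ U, c U * p ^ U.card) := by
    rw [lintegral_finsetSum _ fun U _ => measurable_const.indicator (hS U),
      ENNReal.ofReal_sum_of_nonneg fun U _ => mul_nonneg (hc0 U) (by positivity)]
    refine Finset.sum_congr rfl fun U _ => ?_
    rw [lintegral_indicator_const (hS U), hμS, ENNReal.ofReal_mul (hc0 U)]
  have hsub : {ω | ∃ I : Finset α, (I : Set α) ⊆ A ω ∧ IsAntichain (· ≤ ·) (I : Set α) ∧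
      t < I.card} ⊆ {ω | ENNReal.ofReal (Real.exp (l * t)) ≤ f ω} := by
    rintro ω ⟨I, hIA, hI, ht⟩
    have h1 : Real.exp (l * t) ≤ ∑ U ∈ I.powerset, c U := by
      refine le_trans ?_ (hc I hI)
      rw [← Real.exp_nat_mul, Real.exp_le_exp, mul_comm]
      exact mul_le_mul_of_nonneg_right ht.le hl
    refine (ENNReal.ofReal_le_ofReal h1).trans ?_
    rw [ENNReal.ofReal_sum_of_nonneg fun U _ => hc0 U]
    refine le_trans (Finset.sum_le_sum fun U hU => ?_)
      (Finset.sum_le_sum_of_subset (Finset.subset_univ I.powerset))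
    rw [Set.indicator_of_mem]
    refine subset_toMeasurable _ _ (Set.mem_iInter₂.2 fun x hx => ?_)
    exact hIA (Finset.mem_powerset.1 hU hx)
  refine (measure_mono hsub).trans ?_
  have hmarkov := mul_meas_ge_le_lintegral (μ := μ) hf (ENNReal.ofReal (Real.exp (l * t)))
  rw [hint] at hmarkov
  have he : ENNReal.ofReal (Real.exp (-(l * t))) * ENNReal.ofReal (Real.exp (l * t)) = 1 := by
    rw [← ENNReal.ofReal_mul (Real.exp_pos _).le, ← Real.exp_add]
    simp
  calc _ = ENNReal.ofReal (Real.exp (-(l * t))) * (ENNReal.ofReal (Real.exp (l * t)) *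
        μ {ω | ENNReal.ofReal (Real.exp (l * t)) ≤ f ω}) := by rw [← mul_assoc, he, one_mul]
    _ ≤ ENNReal.ofReal (Real.exp (-(l * t))) * ENNReal.ofReal (∑ U, c U * p ^ U.card) := by
      gcongr
    _ ≤ _ := by
      rw [← ENNReal.ofReal_mul (Real.exp_pos _).le]
      exact ENNReal.ofReal_le_ofReal (mul_le_mul_of_nonneg_left hB (Real.exp_pos _).le)

lemma exp_add_mul_exp_le {q θ d x y z : ℝ} (hq : 0 ≤ q) (h : q * Real.exp (-(θ * d)) ≤ θ)
    (hx : x ≤ z - θ) (hy : y ≤ z - θ - θ * d) :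
    Real.exp x + q * Real.exp y ≤ Real.exp z := by
  calc Real.exp x + q * Real.exp y
      ≤ Real.exp (z - θ) + q * Real.exp (z - θ - θ * d) := by gcongr
    _ = Real.exp (z - θ) * (1 + q * Real.exp (-(θ * d))) := by
      rw [sub_eq_add_neg _ (θ * d), Real.exp_add]; ring
    _ ≤ Real.exp (z - θ) * Real.exp θ := by
      gcongr
      linarith [Real.add_one_le_exp θ]
    _ = Real.exp z := by rw [← Real.exp_add]; ring_nf

open Classical in
/-- Supersaturation for arbitrary families when there are at most `a` unbalanced elements. -/
lemma exists_many_above {n : ℕ} (F : Finset (Fin n → Fin 3)) (a η : ℝ) (hη : η ≤ 1)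
    (ha : ((Finset.univ.filter fun x : Fin n → Fin 3 => ¬ IsBalanced x).card : ℝ) ≤ a)
    (haF : a < F.card) (s Q : ℕ) (hs : 0 < s) (hQ : ∀ k, n ≤ 10 * k → Q ≤ k.choose s)
    (hF : ((4 * s - 3 : ℕ) : ℝ) * ell n n ≤ (1 - η) * (F.card - a)) :
    ∃ v ∈ F, η * Q ≤ ((F.filter fun y => v < y).card : ℝ) := by
  set G := F.filter IsBalanced
  have hG : (F.card : ℝ) - a ≤ G.card := by
    have h1 := Finset.card_filter_add_card_filter_not (s := F) IsBalanced
    have h2 : (F.filter fun x => ¬ IsBalanced x).card ≤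
        (Finset.univ.filter fun x : Fin n → Fin 3 => ¬ IsBalanced x).card :=
      Finset.card_le_card (Finset.filter_subset_filter _ (Finset.subset_univ _))
    have h3 : (F.card : ℝ) = G.card + (F.filter fun x => ¬ IsBalanced x).card := by
      exact_mod_cast h1.symm
    have h4 : ((F.filter fun x => ¬ IsBalanced x).card : ℝ) ≤
        (Finset.univ.filter fun x : Fin n → Fin 3 => ¬ IsBalanced x).card := by exact_mod_cast h2
    linarith
  have hpos : (0 : ℝ) < G.card := by linarith
  obtain ⟨v, hv, h⟩ := exists_card_above_ge_of_isBalanced G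
    (Finset.card_pos.1 (by exact_mod_cast hpos))
    (fun x hx => (Finset.mem_filter.1 hx).2) s Q hs hQ
  refine ⟨v, (Finset.mem_filter.1 hv).1, ?_⟩
  have hsub : ((G.filter fun y => v < y).card : ℝ) ≤ (F.filter fun y => v < y).card :=
    Nat.cast_le.2 (Finset.card_le_card (Finset.filter_subset_filter _ (Finset.filter_subset _ _)))
  refine le_trans ?_ hsub
  have h' : (G.card : ℝ) * Q ≤
      ((4 * s - 3 : ℕ) : ℝ) * ell n n * Q + G.card * (G.filter fun y => v < y).card := by
    exact_mod_cast h
  have h1 : ((4 * s - 3 : ℕ) : ℝ) * ell n n ≤ (1 - η) * G.card :=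
    hF.trans (mul_le_mul_of_nonneg_left hG (by linarith))
  have h2 := mul_le_mul_of_nonneg_right h1 (Nat.cast_nonneg (α := ℝ) Q)
  refine le_of_mul_le_mul_left ?_ hpos
  linarith

open Classical in
lemma exists_linear_above {n : ℕ} {l : ℝ} (hl : 0 < l) (hl1 : l ≤ 1 / 4) (hn : 60 ≤ n)
    (hunbal : ((Finset.univ.filter fun x : Fin n → Fin 3 => ¬ IsBalanced x).card : ℝ) ≤
      l / 2 * ell n n) (F : Finset (Fin n → Fin 3)) (hF : (1 + l) * ell n n < F.card) :
    ∃ v ∈ F, l * n / 80 ≤ ((F.filter fun y => v < y).card : ℝ) := by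
  have hm : (0 : ℝ) ≤ ell n n := Nat.cast_nonneg _
  have hlm : l * ell n n ≤ 1 / 4 * ell n n := mul_le_mul_of_nonneg_right hl1 hm
  have hlm0 : 0 ≤ l * ell n n := mul_nonneg hl.le hm
  obtain ⟨v, hv, hdeg⟩ := exists_many_above F (l / 2 * ell n n) (l / 4) (by linarith) hunbal
    (by linarith) 1 (n / 10) one_pos (fun k hk => by rw [Nat.choose_one_right]; omega) (by
      have h1 : (1 + l / 2) * ell n n ≤ F.card - l / 2 * ell n n := by linarith
      refine le_trans ?_ (mul_le_mul_of_nonneg_left h1 (by linarith : 0 ≤ 1 - l / 4))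
      norm_num
      rw [← mul_assoc]
      exact le_mul_of_one_le_left hm (by nlinarith))
  refine ⟨v, hv, le_trans ?_ hdeg⟩
  have h1 : n ≤ 20 * (n / 10) := by omega
  have h2 : (n : ℝ) ≤ 20 * (n / 10 : ℕ) := by exact_mod_cast h1
  have h3 := mul_le_mul_of_nonneg_left h2 hl.le
  linarith

open Classical in
lemma exists_cubic_above {n : ℕ} {l : ℝ} (hl1 : l ≤ 1 / 4) (hn : 60 ≤ n)
    (hunbal : ((Finset.univ.filter fun x : Fin n → Fin 3 => ¬ IsBalanced x).card : ℝ) ≤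
      l / 2 * ell n n) (F : Finset (Fin n → Fin 3)) (hF : 21 * (ell n n : ℝ) < F.card) :
    ∃ v ∈ F, (n : ℝ) ^ 3 / 96000 ≤ ((F.filter fun y => v < y).card : ℝ) := by
  have hm : (0 : ℝ) ≤ ell n n := Nat.cast_nonneg _
  have hlm : l * ell n n ≤ 1 / 4 * ell n n := mul_le_mul_of_nonneg_right hl1 hm
  obtain ⟨v, hv, hdeg⟩ := exists_many_above F (l / 2 * ell n n) (1 / 2) (by norm_num) hunbal
    (by linarith) 3 ((n / 10).choose 3) (by norm_num)
    (fun k hk => Nat.choose_le_choose 3 (by omega)) (by norm_num; linarith)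
  refine ⟨v, hv, le_trans ?_ hdeg⟩
  have h1 : (n : ℝ) / 20 ≤ (n / 10 + 1 - 3 : ℕ) := by
    have h1 : n ≤ 20 * (n / 10 + 1 - 3) := by omega
    have h2 : (n : ℝ) ≤ 20 * (n / 10 + 1 - 3 : ℕ) := by exact_mod_cast h1
    linarith
  have h2 := Nat.pow_le_choose (α := ℝ) 3 (n / 10)
  have h3 := pow_le_pow_left₀ (by positivity) h1 3
  rw [show ((Nat.factorial 3 : ℕ) : ℝ) = 6 by norm_num [Nat.factorial]] at h2
  have h4 : ((n : ℝ) / 20) ^ 3 = n ^ 3 / 8000 := by ring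
  linarith

open Classical in
lemma cast_card_sub_above {α : Type*} [PartialOrder α] {F : Finset α} {v : α} (hv : v ∈ F) :
    ((F.card - 1 : ℕ) : ℝ) = F.card - 1 ∧
    ((F.card - 1 - (F.filter fun y => v < y).card : ℕ) : ℝ) =
      F.card - 1 - (F.filter fun y => v < y).card := by
  have h1 : (F.filter fun y => v < y).card ≤ F.card - 1 := by
    rw [← Finset.card_erase_of_mem hv]
    refine Finset.card_le_card fun y hy => ?_
    obtain ⟨hy, hlt⟩ := Finset.mem_filter.1 hy
    exact Finset.mem_erase.2 ⟨hlt.ne', hy⟩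
  have h2 : 0 < F.card := Finset.card_pos.2 ⟨v, hv⟩
  rw [Nat.cast_sub h1, Nat.cast_sub h2, Nat.cast_one]
  exact ⟨rfl, rfl⟩

/-- Bound for the exponential moment of the largest antichain among `N` random elements. -/
noncomputable def momentBound (n : ℕ) (p l : ℝ) (N : ℕ) : ℝ :=
  Real.exp (p * (Real.exp l - 1) * ((1 + l) * ell n n) +
    l ^ 2 * p / 100 * min (N : ℝ) (21 * ell n n) + l ^ 2 * p * ell n n / (4 * 3 ^ n) * N)

lemma exp_le_two {l : ℝ} (hl : l ≤ 1 / 4) : Real.exp l ≤ 2 := by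
  have h := Real.exp_one_lt_d9
  have h1 : Real.exp l ^ 4 ≤ Real.exp 1 := by
    rw [← Real.exp_nat_mul, Real.exp_le_exp]
    push_cast
    linarith
  by_contra! h2
  have := pow_lt_pow_left₀ h2 (by norm_num) (by norm_num : (4 : ℕ) ≠ 0)
  linarith

lemma exp_neg_le_inv {x y : ℝ} (hy : 0 < y) (h : y ≤ x) : Real.exp (-x) ≤ y⁻¹ := by
  rw [Real.exp_neg]
  exact inv_anti₀ hy (by linarith [Real.add_one_le_exp x])

open Classical in
lemma momentBound_step {n : ℕ} {p l : ℝ} (hl : 0 < l) (hl1 : l ≤ 1 / 4) (hn : 60 ≤ n)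
    (hnl : 48 / l ^ 2 ≤ n) (hp : 1600000 / l ^ 5 / n ≤ p) (hm : (3 : ℝ) ^ n ≤ 3 * n * ell n n)
    (hunbal : ((Finset.univ.filter fun x : Fin n → Fin 3 => ¬ IsBalanced x).card : ℝ) ≤
      l / 2 * ell n n) (F : Finset (Fin n → Fin 3)) :
    (1 + p * (Real.exp l - 1)) ^ F.card ≤ momentBound n p l F.card ∨
      ∃ v ∈ F, momentBound n p l (F.card - 1) + p * Real.exp l *
        momentBound n p l (F.card - 1 - (F.filter fun y => v < y).card) ≤
          momentBound n p l F.card := by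
  have hn0 : (60 : ℝ) ≤ n := by exact_mod_cast hn
  have hnpos : (0 : ℝ) < n := by linarith
  have hp0 : 0 < p := lt_of_lt_of_le (by positivity) hp
  have hpn : 1600000 ≤ p * n * l ^ 5 := by
    rw [div_div, div_le_iff₀ (by positivity)] at hp
    linarith
  have h3 : (0 : ℝ) < 3 ^ n := by positivity
  have hmpos : (0 : ℝ) < ell n n := by
    by_contra! h
    have : 3 * (n : ℝ) * ell n n ≤ 0 := mul_nonpos_of_nonneg_of_nonpos (by positivity) h
    linarith
  have hel : 0 ≤ Real.exp l - 1 := sub_nonneg.2 (Real.one_le_exp hl.le)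
  have hel2 := exp_le_two hl1
  unfold momentBound
  set m : ℝ := (ell n n : ℝ)
  set β : ℝ := p * (Real.exp l - 1)
  set θ₂ : ℝ := l ^ 2 * p / 100 with hθ₂
  set θ₁ : ℝ := l ^ 2 * p * m / (4 * 3 ^ n) with hθ₁
  have hβ : 0 ≤ β := by positivity
  have hθ₁0 : 0 ≤ θ₁ := by positivity
  have hθ₂0 : 0 ≤ θ₂ := by positivity
  rcases le_or_gt (F.card : ℝ) ((1 + l) * m) with hsmall | hlarge
  · left
    calc (1 + β) ^ F.card ≤ Real.exp β ^ F.card := by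
          gcongr
          linarith [Real.add_one_le_exp β]
      _ = Real.exp (β * F.card) := by rw [← Real.exp_nat_mul, mul_comm]
      _ ≤ _ := by
        rw [Real.exp_le_exp]
        have h1 : 0 ≤ θ₂ * min (F.card : ℝ) (21 * m) := by positivity
        have h2 : 0 ≤ θ₁ * F.card := by positivity
        have h3 := mul_le_mul_of_nonneg_left hsmall hβ
        linarith
  right
  rcases le_or_gt (F.card : ℝ) (21 * m) with hmid | hbig
  · obtain ⟨v, hv, hd⟩ := exists_linear_above hl hl1 hn hunbal F hlarge
    refine ⟨v, hv, ?_⟩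
    obtain ⟨hc1, hc2⟩ := cast_card_sub_above hv
    set d := ((F.filter fun y => v < y).card : ℝ)
    have hd0 : 0 ≤ d := Nat.cast_nonneg _
    have hx : 200 / l ^ 2 ≤ θ₂ * d := by
      refine le_trans ?_ (mul_le_mul_of_nonneg_left hd hθ₂0)
      rw [hθ₂, div_le_iff₀ (by positivity)]
      linarith
    have hexp := exp_neg_le_inv (by positivity) hx
    rw [hc1, hc2, min_eq_left hmid, min_eq_left (by linarith), min_eq_left (by linarith)]
    refine exp_add_mul_exp_le (θ := θ₂) (d := d) (by positivity) ?_ ?_ ?_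
    · calc p * Real.exp l * Real.exp (-(θ₂ * d)) ≤ p * 2 * (200 / l ^ 2)⁻¹ := by gcongr
        _ = θ₂ := by rw [hθ₂]; field_simp; norm_num
    · linarith
    · have : 0 ≤ θ₁ * d := by positivity
      linarith
  · obtain ⟨v, hv, hd⟩ := exists_cubic_above hl1 hn hunbal F hbig
    refine ⟨v, hv, ?_⟩
    obtain ⟨hc1, hc2⟩ := cast_card_sub_above hv
    set d := ((F.filter fun y => v < y).card : ℝ)
    have hd0 : 0 ≤ d := Nat.cast_nonneg _
    have hmn : l ^ 2 / (12 * n) ≤ l ^ 2 * m / (4 * 3 ^ n) := by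
      rw [div_le_div_iff₀ (by positivity) (by positivity)]
      have := mul_le_mul_of_nonneg_left hm (sq_nonneg l)
      linarith
    have hx : (n : ℝ) ≤ θ₁ * d := by
      have h1 : p * (l ^ 2 / (12 * n)) ≤ θ₁ := by
        calc _ ≤ p * (l ^ 2 * m / (4 * 3 ^ n)) := mul_le_mul_of_nonneg_left hmn hp0.le
          _ = θ₁ := by rw [hθ₁]; ring
      refine le_trans ?_ (mul_le_mul h1 hd (by positivity) hθ₁0)
      have h2 : p * (l ^ 2 / (12 * n)) * ((n : ℝ) ^ 3 / 96000) = p * n * l ^ 2 / 1152000 * n := by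
        field_simp
        ring
      rw [h2]
      have h3 : p * n * l ^ 5 ≤ p * n * l ^ 2 := by
        have : l ^ 5 ≤ l ^ 2 := pow_le_pow_of_le_one hl.le (by linarith) (by norm_num)
        gcongr
      refine le_mul_of_one_le_left hnpos.le ?_
      linarith
    have hexp : Real.exp (-(θ₁ * d)) ≤ ((n : ℝ) ^ 2 / 2)⁻¹ := by
      rw [Real.exp_neg]
      refine inv_anti₀ (by positivity) ?_
      have h1 := Real.quadratic_le_exp_of_nonneg hnpos.le
      have h2 := Real.exp_le_exp.2 hx
      linarith
    have hmin : ∀ N : ℝ, N ≤ F.card → min N (21 * m) ≤ min (F.card : ℝ) (21 * m) :=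
      fun N hN => min_le_min_right _ hN
    rw [hc1, hc2]
    refine exp_add_mul_exp_le (θ := θ₁) (d := d) (by positivity) ?_ ?_ ?_
    · calc p * Real.exp l * Real.exp (-(θ₁ * d)) ≤ p * 2 * ((n : ℝ) ^ 2 / 2)⁻¹ := by gcongr
        _ ≤ p * (l ^ 2 / (12 * n)) := by
          rw [mul_assoc]
          refine mul_le_mul_of_nonneg_left ?_ hp0.le
          rw [div_le_iff₀ (by positivity)] at hnl
          rw [inv_div, ← mul_div_assoc, div_le_div_iff₀ (by positivity) (by positivity)]
          have := mul_le_mul_of_nonneg_right hnl hnpos.le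
          linarith
        _ ≤ p * (l ^ 2 * m / (4 * 3 ^ n)) := mul_le_mul_of_nonneg_left hmn hp0.le
        _ = θ₁ := by rw [hθ₁]; ring
    · have := mul_le_mul_of_nonneg_left (hmin (F.card - 1) (by linarith)) hθ₂0
      linarith
    · have := mul_le_mul_of_nonneg_left (hmin (F.card - 1 - d) (by linarith)) hθ₂0
      linarith

lemma exp_neg_mul_momentBound_le {n : ℕ} {p l : ℝ} (hl : 0 < l) (hl1 : l ≤ 1 / 4) (hp : 0 ≤ p) :
    Real.exp (-(l * ((1 + 4 * l) * p * ell n n))) * momentBound n p l (3 ^ n) ≤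
      Real.exp (-(l ^ 2 * p * ell n n / 2)) := by
  unfold momentBound
  rw [← Real.exp_add, Real.exp_le_exp]
  set m : ℝ := (ell n n : ℝ)
  have hm : 0 ≤ p * m := mul_nonneg hp (Nat.cast_nonneg _)
  have h1 : Real.exp l - 1 ≤ l + l ^ 2 := by
    have := (abs_le.1 (Real.abs_exp_sub_one_sub_id_le (x := l) (by
      rw [abs_of_pos hl]; linarith))).2
    linarith
  have h2 : l ^ 2 * p / 100 * min (((3 ^ n : ℕ) : ℕ) : ℝ) (21 * m) ≤
      l ^ 2 * p / 100 * (21 * m) := by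
    gcongr
    exact min_le_right _ _
  have h3 : l ^ 2 * p * m / (4 * 3 ^ n) * ((3 ^ n : ℕ) : ℝ) = l ^ 2 * p * m / 4 := by
    push_cast
    field_simp
  have h4 : p * (Real.exp l - 1) * ((1 + l) * m) ≤ p * m * ((l + l ^ 2) * (1 + l)) := by
    calc _ = p * m * ((Real.exp l - 1) * (1 + l)) := by ring
      _ ≤ _ := by gcongr
  have h5 : p * m * ((l + l ^ 2) * (1 + l)) ≤ p * m * (l * (1 + 4 * l) - l ^ 2) := by
    refine mul_le_mul_of_nonneg_left ?_ hm
    nlinarith [pow_pos hl 2, pow_pos hl 3]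
  rw [h3]
  nlinarith [mul_nonneg hm (sq_nonneg l)]

open Filter in
lemma eventually_size_bounds (l δ : ℝ) (hl : 0 < l) (hδ : 0 < δ) :
    ∀ᶠ n : ℕ in atTop, 60 ≤ n ∧ 48 / l ^ 2 ≤ (n : ℝ) ∧ (n : ℝ) ^ 3 ≤ 3 ^ n ∧
      (n : ℝ)⁻¹ ≤ δ ∧ n * (999 / 1000 : ℝ) ^ n ≤ l / 18 := by
  have h1 : ∀ᶠ n : ℕ in atTop, (n : ℝ) ^ 3 / 3 ^ n ≤ 1 :=
    (tendsto_pow_const_div_const_pow_of_one_lt 3 (by norm_num : (1 : ℝ) < 3)).eventually_le_const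
      one_pos
  have h2 : ∀ᶠ n : ℕ in atTop, (n : ℝ)⁻¹ ≤ δ :=
    tendsto_inv_atTop_nhds_zero_nat.eventually_le_const hδ
  have h3 : ∀ᶠ n : ℕ in atTop, n * (999 / 1000 : ℝ) ^ n ≤ l / 18 :=
    (tendsto_self_mul_const_pow_of_lt_one (by norm_num) (by norm_num)).eventually_le_const
      (by positivity)
  have h4 : ∀ᶠ n : ℕ in atTop, 48 / l ^ 2 ≤ (n : ℝ) :=
    tendsto_natCast_atTop_atTop.eventually_ge_atTop _
  filter_upwards [h1, h2, h3, h4, eventually_ge_atTop 60] with n h1 h2 h3 h4 h5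
  refine ⟨h5, h4, ?_, h2, h3⟩
  rwa [div_le_one (by positivity)] at h1

/-- With high probability, every antichain in a `p`-random subset of the poset
`{0,1,2}^n` has cardinality at most `(1+ε) p ℓ_n(n)`, provided `p ≥ c(ε)/n`.
The `p`-random subset is modelled as a random set `A` on an arbitrary probability
space whose membership events are independent and each have probability `p`. -/
theorem randomMultisetAntichain (ε : ℝ) (hε : 0 < ε) :
    ∃ c : ℝ, 0 < c ∧ ∀ δ : ℝ, 0 < δ → ∃ n0 : ℕ, ∀ n : ℕ, n0 ≤ n →
      ∀ p : ℝ, c / (n : ℝ) ≤ p → p ≤ 1 →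
        ∀ (Ω : Type) [MeasurableSpace Ω] (μ : Measure Ω) [IsProbabilityMeasure μ]
          (A : Ω → Set (Fin n → Fin 3)),
          iIndepSet (fun x => {ω | x ∈ A ω}) μ →
          (∀ x : Fin n → Fin 3, μ {ω | x ∈ A ω} = ENNReal.ofReal p) →
          ENNReal.ofReal (1 - δ) ≤
            μ {ω | ∀ I : Finset (Fin n → Fin 3),
                (I : Set (Fin n → Fin 3)) ⊆ A ω →
                IsAntichain (· ≤ ·) (I : Set (Fin n → Fin 3)) →
                (I.card : ℝ) ≤ (1 + ε) * p * (ell n n : ℝ)} := by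
  classical
  obtain ⟨l, hl, hl1, hlε⟩ : ∃ l : ℝ, 0 < l ∧ l ≤ 1 / 4 ∧ 4 * l ≤ ε :=
    ⟨min (ε / 4) (1 / 4), by positivity, min_le_right _ _, by
      linarith [min_le_left (ε / 4) (1 / 4)]⟩
  refine ⟨1600000 / l ^ 5, by positivity, fun δ hδ => ?_⟩
  obtain ⟨n₀, hn₀⟩ := Filter.eventually_atTop.1 (eventually_size_bounds l δ hl hδ)
  refine ⟨n₀, fun n hn p hp _ Ω _ μ _ A hind hA => ?_⟩
  obtain ⟨h60, hnl, hn3, hnδ, hq⟩ := hn₀ n hn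
  have hn0 : (60 : ℝ) ≤ n := by exact_mod_cast h60
  have hnpos : (0 : ℝ) < n := by linarith
  have hp0 : 0 < p := lt_of_lt_of_le (by positivity) hp
  have hm : (3 : ℝ) ^ n ≤ 3 * n * ell n n := by
    have h1 : (3 : ℝ) ^ n ≤ (2 * n + 1) * ell n n := by exact_mod_cast three_pow_le n
    refine h1.trans ?_
    gcongr
    linarith
  have hunbal := (card_filter_not_isBalanced_le n).trans (show _ ≤ l / 2 * (ell n n : ℝ) by
    calc 3 * (999 / 1000 : ℝ) ^ n * 3 ^ n ≤ 3 * (999 / 1000 : ℝ) ^ n * (3 * n * ell n n) := by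
          gcongr
      _ = 9 * (n * (999 / 1000 : ℝ) ^ n) * ell n n := by ring
      _ ≤ 9 * (l / 18) * ell n n := by gcongr
      _ = l / 2 * ell n n := by ring)
  obtain ⟨c, hc0, -, hc, hcsum⟩ := exists_antichain_weights p l hp0.le hl.le (momentBound n p l)
    (momentBound_step hl hl1 h60 hnl hp hm hunbal) Finset.univ
  have hcard : (Finset.univ : Finset (Fin n → Fin 3)).card = 3 ^ n := by simp
  rw [Finset.powerset_univ, hcard] at hcsum
  have hbad := measure_exists_antichain_le μ A p hp0.le hind hA l ((1 + 4 * l) * p * ell n n) _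
    hl.le c hc0 (fun I hI => hc I (Finset.subset_univ I) hI) hcsum
  have hy : (n : ℝ) ≤ l ^ 2 * p * ell n n / 2 := by
    have h1 : (n : ℝ) ^ 2 ≤ 3 * ell n n := by
      have := hn3.trans hm
      nlinarith
    have h2 : 1600000 ≤ p * n * l ^ 5 := by
      rw [div_div, div_le_iff₀ (by positivity)] at hp
      linarith
    have h3 : p * n * l ^ 5 ≤ p * n * l ^ 2 := by
      have : l ^ 5 ≤ l ^ 2 := pow_le_pow_of_le_one hl.le (by linarith) (by norm_num)
      gcongr
    have h4 := mul_le_mul_of_nonneg_left h1 (by positivity : 0 ≤ l ^ 2 * p)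
    nlinarith
  have hδbad : Real.exp (-(l * ((1 + 4 * l) * p * ell n n))) * momentBound n p l (3 ^ n) ≤ δ :=
    ((exp_neg_mul_momentBound_le hl hl1 hp0.le).trans (exp_neg_le_inv hnpos hy)).trans hnδ
  have hbad' := hbad.trans (ENNReal.ofReal_le_ofReal hδbad)
  set good : Set Ω := {ω | ∀ I : Finset (Fin n → Fin 3), (I : Set (Fin n → Fin 3)) ⊆ A ω →
    IsAntichain (· ≤ ·) (I : Set (Fin n → Fin 3)) → (I.card : ℝ) ≤ (1 + ε) * p * (ell n n : ℝ)}
  have hcover : μ Set.univ ≤ μ good + ENNReal.ofReal δ := by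
    refine (measure_mono fun ω _ => ?_).trans ((measure_union_le good _).trans
      (add_le_add_right hbad' _))
    by_cases hω : ω ∈ good
    · exact Or.inl hω
    · right
      simp only [good, Set.mem_ofPred_eq, not_forall, not_le] at hω ⊢
      obtain ⟨I, hIA, hI, hlt⟩ := hω
      refine ⟨I, hIA, hI, lt_of_le_of_lt ?_ hlt⟩
      gcongr
  rw [measure_univ] at hcover
  rw [ENNReal.ofReal_sub 1 hδ.le, ENNReal.ofReal_one]
  exact tsub_le_iff_right.2 hcover
end

section
/- Let P be a finite poset, let D be a comparability digraph for P, and let μ be a probability distribution on the chains of P; let C_μ denote a random chain with law μ. Suppose that P(x ∈ C_μ) > 0 for every x ∈ P, and suppose that M > 0 and m > 0 are real numbers such that P(y ∈ C_μ | x ∈ C_μ) ≤ M for every arc (x,y) of D and m ≤ P(x ∈ C_μ) for every x ∈ P. Then for every subset S of P, comp(S) ≥ M^{−1}·(|S| − m^{−1}). -/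
/-- The number of comparable pairs (unordered pairs of distinct comparable elements)
in a finite subset `S` of a poset. -/
noncomputable def compPairs {α : Type*} [PartialOrder α] (S : Finset α) : ℕ :=
  Nat.card {p : α × α // p.1 ∈ S ∧ p.2 ∈ S ∧ p.1 < p.2}

open Classical in
/-- In a finite set on which `R` is total on distinct elements, at most one element has no
out-neighbour, so summing a weight over the arcs loses at most one term. -/
theorem sum_le_add_sum_arcs {α : Type*} (R : α → α → Prop) (T : Finset α) (f : α → ℝ) (b : ℝ)
    (hR : ∀ x ∈ T, ∀ y ∈ T, x ≠ y → R x y ∨ R y x)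
    (hf : ∀ x ∈ T, 0 ≤ f x) (hfb : ∀ x ∈ T, f x ≤ b) (hb : 0 ≤ b) :
    ∑ x ∈ T, f x ≤ b + ∑ x ∈ T, ∑ y ∈ T, if R x y then f x else 0 := by
  have hnonneg : ∀ x ∈ T, ∀ y ∈ T, 0 ≤ if R x y then f x else 0 := by
    intro x hx y _
    split_ifs
    exacts [hf x hx, le_rfl]
  have hout : ∀ x ∈ T, (∃ y ∈ T, R x y) → f x ≤ ∑ y ∈ T, if R x y then f x else 0 := by
    rintro x hx ⟨y, hy, hxy⟩
    have h := Finset.single_le_sum (hnonneg x hx) hy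
    rwa [if_pos hxy] at h
  by_cases hsink : ∃ x ∈ T, ∀ y ∈ T, ¬ R x y
  · obtain ⟨z, hz, hzout⟩ := hsink
    rw [← Finset.add_sum_erase T f hz, ← Finset.add_sum_erase T _ hz]
    refine add_le_add (hfb z hz) (le_add_of_nonneg_of_le
      (Finset.sum_nonneg (hnonneg z hz)) (Finset.sum_le_sum fun x hx => ?_))
    obtain ⟨hxz, hxT⟩ := Finset.mem_erase.mp hx
    exact hout x hxT ⟨z, hz, (hR x hxT z hz hxz).resolve_right (hzout x hxT)⟩
  · push Not at hsink
    exact le_add_of_nonneg_of_le hb (Finset.sum_le_sum fun x hx => hout x hx (hsink x hx))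

open Classical in
/-- An orientation of the comparability graph has at most `compPairs S` arcs inside `S`. -/
theorem card_arcs_le_compPairs {α : Type*} [PartialOrder α] [Finite α]
    (D : α → α → Prop) (hcomp : ∀ x y : α, D x y → x ≠ y ∧ (x ≤ y ∨ y ≤ x))
    (hasymm : ∀ x y : α, D x y → ¬ D y x) (S : Finset α) :
    ((S ×ˢ S).filter fun q => D q.1 q.2).card ≤ compPairs S := by
  have hlt : ∀ x y : α, D x y → ¬ x < y → y < x := fun x y h hn => by
    obtain ⟨hne, hle | hle⟩ := hcomp x y h
    exacts [absurd (lt_of_le_of_ne hle hne) hn, lt_of_le_of_ne hle hne.symm]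
  have hfin : {p : α × α | p.1 ∈ S ∧ p.2 ∈ S ∧ p.1 < p.2}.Finite := Set.toFinite _
  change _ ≤ {p : α × α | p.1 ∈ S ∧ p.2 ∈ S ∧ p.1 < p.2}.ncard
  rw [← Set.ncard_coe_finset]
  refine Set.ncard_le_ncard_of_injOn (fun q => if q.1 < q.2 then q else q.swap) ?_ ?_ hfin
  · rintro ⟨x, y⟩ hq
    simp only [Finset.coe_filter, Finset.mem_product, Set.mem_ofPred_eq] at hq
    obtain ⟨⟨hx, hy⟩, hD⟩ := hq
    by_cases h : x < y
    · simpa [h] using ⟨hx, hy⟩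
    · simpa [h] using ⟨hy, hx, hlt x y hD h⟩
  · rintro ⟨x, y⟩ hq ⟨x', y'⟩ hq' heq
    simp only [Finset.coe_filter, Finset.mem_product, Set.mem_ofPred_eq] at hq hq'
    have h₁ := hasymm x y hq.2
    have h₂ := hasymm x' y' hq'.2
    dsimp only at heq
    split_ifs at heq <;> simp only [Prod.swap_prod_mk, Prod.mk.injEq] at heq ⊢ <;>
      obtain ⟨rfl, rfl⟩ := heq
    · exact ⟨rfl, rfl⟩
    · exact absurd hq'.2 h₁
    · exact absurd hq'.2 h₁
    · exact ⟨rfl, rfl⟩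

/-- Counting comparable pairs via a random chain.  The distribution `μ` on the chains
of the finite poset `α` is given by a weight function `w` on finsets, supported on
chains, with nonnegative weights summing to `1`.  `D` is a comparability digraph:
every arc joins two distinct comparable elements, and every comparable pair of
distinct elements carries exactly one arc.  If every conditional probability
`P(y ∈ C | x ∈ C)` along arcs is at most `M`, and `P(x ∈ C) ≥ m > 0` for every `x`,
then every `S` satisfies `comp(S) ≥ M⁻¹ (|S| - m⁻¹)`. -/
theorem randomChainCount {α : Type*} [PartialOrder α] [Fintype α] [DecidableEq α]
    (D : α → α → Prop)
    (hD1 : ∀ x y : α, D x y → x ≠ y ∧ (x ≤ y ∨ y ≤ x))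
    (hD2 : ∀ x y : α, x ≠ y → (x ≤ y ∨ y ≤ x) → Xor' (D x y) (D y x))
    (w : Finset α → ℝ)
    (hw0 : ∀ c : Finset α, 0 ≤ w c)
    (hw1 : ∑ c : Finset α, w c = 1)
    (hwchain : ∀ c : Finset α, w c ≠ 0 → IsChain (· ≤ ·) (c : Set α))
    (M m : ℝ) (hM : 0 < M) (hm : 0 < m)
    (hpos : ∀ x : α, 0 < ∑ c ∈ Finset.univ.filter (fun c : Finset α => x ∈ c), w c)
    (hcond : ∀ x y : α, D x y →
      (∑ c ∈ Finset.univ.filter (fun c : Finset α => x ∈ c ∧ y ∈ c), w c) /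
        (∑ c ∈ Finset.univ.filter (fun c : Finset α => x ∈ c), w c) ≤ M)
    (hmin : ∀ x : α, m ≤ ∑ c ∈ Finset.univ.filter (fun c : Finset α => x ∈ c), w c) :
    ∀ S : Finset α, M⁻¹ * ((S.card : ℝ) - m⁻¹) ≤ (compPairs S : ℝ) := by
  classical
  intro S
  set p : α → ℝ := fun x => ∑ c ∈ Finset.univ.filter (fun c : Finset α => x ∈ c), w c with hp
  have hasymm : ∀ x y : α, D x y → ¬ D y x := fun x y hxy hyx => by
    rcases hD2 x y (hD1 x y hxy).1 (hD1 x y hxy).2 with h | h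
    exacts [h.2 hyx, h.2 hxy]
  have hchain : ∀ c : Finset α, w c * ∑ x ∈ S ∩ c, (p x)⁻¹ ≤
      w c * (m⁻¹ + ∑ x ∈ S ∩ c, ∑ y ∈ S ∩ c, if D x y then (p x)⁻¹ else 0) := by
    intro c
    by_cases hc : w c = 0
    · simp [hc]
    · refine mul_le_mul_of_nonneg_left (sum_le_add_sum_arcs D _ _ _ ?_
        (fun x _ => (inv_pos.mpr (hpos x)).le) (fun x _ => inv_anti₀ hm (hmin x))
        (inv_pos.mpr hm).le) (hw0 c)
      intro x hx y hy hxy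
      have hcmp := hwchain c hc (Finset.mem_coe.mpr (Finset.mem_inter.mp hx).2)
        (Finset.mem_coe.mpr (Finset.mem_inter.mp hy).2) hxy
      exact Xor.or (hD2 x y hxy hcmp)
  have hcard : ∑ c : Finset α, w c * ∑ x ∈ S ∩ c, (p x)⁻¹ = S.card := by
    calc ∑ c : Finset α, w c * ∑ x ∈ S ∩ c, (p x)⁻¹
        = ∑ c : Finset α, ∑ x ∈ S, if x ∈ c then w c * (p x)⁻¹ else 0 := by
          simp only [← Finset.filter_mem_eq_inter, Finset.mul_sum, Finset.sum_filter, mul_ite, mul_zero]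
      _ = ∑ x ∈ S, p x * (p x)⁻¹ := by
          rw [Finset.sum_comm]
          refine Finset.sum_congr rfl fun x _ => ?_
          rw [← Finset.sum_filter, ← Finset.sum_mul]
      _ = S.card := by
          rw [Finset.sum_congr rfl fun x _ => mul_inv_cancel₀ (hpos x).ne']
          simp
  have harcs : ∑ c : Finset α, w c *
      ∑ x ∈ S ∩ c, ∑ y ∈ S ∩ c, (if D x y then (p x)⁻¹ else 0) ≤ compPairs S * M := by
    calc ∑ c : Finset α, w c * ∑ x ∈ S ∩ c, ∑ y ∈ S ∩ c, (if D x y then (p x)⁻¹ else 0)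
        = ∑ c : Finset α, ∑ q ∈ (S ×ˢ S).filter (fun q => D q.1 q.2),
            if q.1 ∈ c ∧ q.2 ∈ c then w c / p q.1 else 0 := by
          refine Finset.sum_congr rfl fun c _ => ?_
          rw [Finset.sum_filter, Finset.sum_product]
          simp only [← Finset.filter_mem_eq_inter, Finset.sum_filter, Finset.mul_sum]
          refine Finset.sum_congr rfl fun x _ => ?_
          by_cases hx : x ∈ c
          · rw [if_pos hx, Finset.mul_sum]
            refine Finset.sum_congr rfl fun y _ => ?_
            by_cases hy : y ∈ c <;> by_cases hxy : D x y <;> simp [hx, hy, hxy, div_eq_mul_inv]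
          · simp [hx]
      _ = ∑ q ∈ (S ×ˢ S).filter (fun q => D q.1 q.2),
            (∑ c ∈ Finset.univ.filter (fun c : Finset α => q.1 ∈ c ∧ q.2 ∈ c), w c) / p q.1 := by
          rw [Finset.sum_comm]
          refine Finset.sum_congr rfl fun q _ => ?_
          rw [← Finset.sum_filter, Finset.sum_div]
      _ ≤ ((S ×ˢ S).filter fun q => D q.1 q.2).card • M :=
          Finset.sum_le_card_nsmul _ _ _ fun q hq => hcond q.1 q.2 (Finset.mem_filter.mp hq).2
      _ ≤ compPairs S * M := by
          rw [nsmul_eq_mul]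
          exact mul_le_mul_of_nonneg_right
            (Nat.cast_le.mpr (card_arcs_le_compPairs D hD1 hasymm S)) hM.le
  have htotal := Finset.sum_le_sum fun c (_ : c ∈ Finset.univ) => hchain c
  simp only [mul_add, Finset.sum_add_distrib] at htotal
  rw [hcard, ← Finset.sum_mul, hw1, one_mul] at htotal
  rw [inv_mul_le_iff₀ hM]
  linarith
end

section
/- Let d and m be positive integers and let P be a finite poset such that |P| > m and every subset S of P of cardinality greater than m satisfies comp(S) ≥ |S|·d. Then there exists a function f from the collection of subsets of P of cardinality at most |P|/(2d+1) to the collection of subsets of P of cardinality at most m, such that for every antichain I ⊆ P there exists a subset T of I with |T| ≤ |P|/(2d+1), T ∩ f(T) = ∅, and I ⊆ T ∪ f(T). -/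
open Classical in
/-- Counting comparable pairs by their lower element. -/
theorem compPairs_eq_sum_above {α : Type*} [PartialOrder α] (S : Finset α) :
    compPairs S = ∑ v ∈ S, (S.filter (v < ·)).card := by
  have h : compPairs S = ((S ×ˢ S).filter fun p => p.1 < p.2).card := by
    refine Nat.subtype_card _ ?_
    intro p
    simp [and_assoc]
  rw [h, Finset.card_filter, Finset.sum_product]
  simp only [Finset.card_filter]

open Classical in
/-- Counting comparable pairs by their upper element. -/
theorem compPairs_eq_sum_below {α : Type*} [PartialOrder α] (S : Finset α) :
    compPairs S = ∑ v ∈ S, (S.filter (· < v)).card := by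
  rw [compPairs_eq_sum_above]
  simp only [Finset.card_filter]
  exact Finset.sum_comm

open Classical in
/-- A nonempty set with at least `d` comparable pairs per element has an element that is
comparable to at least `2 * d + 1` elements of the set, itself included. -/
theorem exists_le_card_comparable {α : Type*} [PartialOrder α] {S : Finset α} {d : ℕ}
    (hS : S.Nonempty) (h : S.card * d ≤ compPairs S) :
    ∃ v ∈ S, 2 * d + 1 ≤ (S.filter fun x => x ≤ v ∨ v ≤ x).card := by
  obtain ⟨v, hv, hle⟩ : ∃ v ∈ S,
      2 * d ≤ (S.filter (v < ·)).card + (S.filter (· < v)).card := by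
    apply Finset.exists_le_of_sum_le hS
    rw [Finset.sum_add_distrib, ← compPairs_eq_sum_above, ← compPairs_eq_sum_below,
      Finset.sum_const, smul_eq_mul]
    linarith
  refine ⟨v, hv, ?_⟩
  have hdisj : Disjoint (S.filter (v < ·)) (S.filter (· < v)) :=
    Finset.disjoint_filter.2 fun x _ h₁ h₂ => lt_asymm h₁ h₂
  have hv' : v ∉ S.filter (v < ·) ∪ S.filter (· < v) := by simp
  calc 2 * d + 1 ≤ (insert v (S.filter (v < ·) ∪ S.filter (· < v))).card := by
        rw [Finset.card_insert_of_notMem hv', Finset.card_union_of_disjoint hdisj]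
        lia
    _ ≤ _ := Finset.card_le_card fun x hx => by
        simp only [Finset.mem_insert, Finset.mem_union, Finset.mem_filter] at hx ⊢
        rcases hx with rfl | ⟨hx, hlt⟩ | ⟨hx, hlt⟩
        · exact ⟨hv, Or.inl le_rfl⟩
        · exact ⟨hx, Or.inr hlt.le⟩
        · exact ⟨hx, Or.inl hlt.le⟩

/-- The container lemma relative to a subset `S` of the poset. -/
theorem exists_container_of_subset {α : Type*} [PartialOrder α] [DecidableEq α] (d m : ℕ)
    (hsat : ∀ S : Finset α, m < S.card → S.card * d ≤ compPairs S) (S : Finset α) :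
    ∃ f : Finset α → Finset α, (∀ T, (f T).card ≤ m) ∧ (∀ T, f T ⊆ S) ∧
      ∀ I ⊆ S, IsAntichain (· ≤ ·) (I : Set α) →
        ∃ T ⊆ I, T.card * (2 * d + 1) ≤ S.card ∧ T ∩ f T = ∅ ∧ I ⊆ T ∪ f T := by
  classical
  induction S using Finset.strongInduction with
  | H S ih =>
    by_cases hm : S.card ≤ m
    · exact ⟨fun _ => S, fun _ => hm, fun _ => subset_rfl, fun I hI _ =>
        ⟨∅, by simp, by simp, by simp, by simpa using hI⟩⟩
    push Not at hm
    obtain ⟨v, hv, hdeg⟩ :=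
      exists_le_card_comparable (Finset.card_pos.1 (by lia)) (hsat S hm)
    set N := S.filter fun x => x ≤ v ∨ v ≤ x with hN
    have hNS : N ⊆ S := Finset.filter_subset _ _
    have hvN : v ∈ N := by simp [hN, hv]
    obtain ⟨f, hfm, hfS, hf⟩ := ih (S.erase v) (Finset.erase_ssubset hv)
    obtain ⟨g, hgm, hgS, hg⟩ := ih (S \ N) (Finset.sdiff_ssubset hNS ⟨v, hvN⟩)
    refine ⟨fun T => if v ∈ T then g (T.erase v) else f T, fun T => ?_, fun T => ?_,
      fun I hI hanti => ?_⟩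
    · dsimp only
      split_ifs
      exacts [hgm _, hfm _]
    · dsimp only
      split_ifs
      exacts [(hgS _).trans Finset.sdiff_subset, (hfS _).trans (Finset.erase_subset _ _)]
    by_cases hvI : v ∈ I
    · have hsub : I.erase v ⊆ S \ N := fun x hx => by
        obtain ⟨hxv, hxI⟩ := Finset.mem_erase.1 hx
        refine Finset.mem_sdiff.2 ⟨hI hxI, fun hxN => ?_⟩
        rcases (Finset.mem_filter.1 hxN).2 with h | h
        · exact hxv (hanti.eq hxI hvI h)
        · exact hxv (hanti.eq hvI hxI h).symm
      obtain ⟨T, hTI, hcard, hdisj, hcover⟩ :=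
        hg (I.erase v) hsub (hanti.subset (by simp))
      have hvT : v ∉ T := fun h => (Finset.mem_erase.1 (hTI h)).1 rfl
      have hvg : v ∉ g T := fun h => (Finset.mem_sdiff.1 (hgS T h)).2 hvN
      refine ⟨insert v T, Finset.insert_subset hvI (hTI.trans (Finset.erase_subset _ _)),
        ?_, ?_, ?_⟩
      · have := Finset.card_sdiff_add_card_eq_card hNS
        rw [Finset.card_insert_of_notMem hvT]
        linarith
      · simp [Finset.erase_insert hvT, Finset.insert_inter_of_notMem hvg, hdisj]
      · simp only [Finset.mem_insert_self, if_true, Finset.erase_insert hvT,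
          Finset.insert_union]
        exact Finset.erase_subset_iff_of_mem (Finset.mem_insert_self _ _) |>.1
          (hcover.trans (Finset.subset_insert _ _))
    · obtain ⟨T, hTI, hcard, hdisj, hcover⟩ := hf I
        (Finset.subset_erase.2 ⟨hI, hvI⟩) hanti
      refine ⟨T, hTI, hcard.trans (Finset.card_le_card (Finset.erase_subset _ _)), ?_, ?_⟩
      · simpa [show v ∉ T from fun h => hvI (hTI h)] using hdisj
      · simpa [show v ∉ T from fun h => hvI (hTI h)] using hcover

/-- Container lemma for antichains in a finite poset. -/
theorem containerLemma {α : Type*} [PartialOrder α] [Fintype α] [DecidableEq α]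
    (d m : ℕ) (hd : 0 < d) (hm : 0 < m) (hPm : m < Fintype.card α)
    (hsat : ∀ S : Finset α, m < S.card → S.card * d ≤ compPairs S) :
    ∃ f : Finset α → Finset α,
      (∀ T : Finset α, (T.card : ℝ) ≤ (Fintype.card α : ℝ) / (2 * d + 1) →
        (f T).card ≤ m) ∧
      ∀ I : Finset α, IsAntichain (· ≤ ·) (I : Set α) →
        ∃ T : Finset α, T ⊆ I ∧ (T.card : ℝ) ≤ (Fintype.card α : ℝ) / (2 * d + 1) ∧
          T ∩ f T = ∅ ∧ I ⊆ T ∪ f T := by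
  obtain ⟨f, hfm, -, hf⟩ := exists_container_of_subset d m hsat Finset.univ
  refine ⟨f, fun T _ => hfm T, fun I hanti => ?_⟩
  obtain ⟨T, hTI, hcard, hdisj, hcover⟩ := hf I (Finset.subset_univ _) hanti
  refine ⟨T, hTI, ?_, hdisj, hcover⟩
  rw [le_div_iff₀ (by positivity)]
  exact_mod_cast hcard
end

section
/- Let k ≥ 1, let d_1 > d_2 > … > d_k and m_0 > m_1 > … > m_k be positive integers, and let P be a finite poset with |P| = m_0 such that for each 1 ≤ j ≤ k, every subset S of P of cardinality greater than m_j satisfies comp(S) ≥ |S|·d_j. Then there exist functions f_1,…,f_k, where f_j maps the collection of subsets of P of cardinality at most Σ_{r=1}^{j} m_{r−1}/(2d_r+1) into the collection of subsets of P of cardinality at most m_j, such that for every antichain I ⊆ P there exist pairwise disjoint subsets T_1,…,T_k of I satisfying: (i) |T_j| ≤ m_{j−1}/(2d_j+1) for 1 ≤ j ≤ k; (ii) T_j ⊆ f_{j−1}(T_1 ∪ … ∪ T_{j−1}) for 2 ≤ j ≤ k−1; (iii) (T_1 ∪ … ∪ T_j) ∩ f_j(T_1 ∪ … ∪ T_j)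 = ∅ for 1 ≤ j ≤ k; and (iv) I ⊆ (T_1 ∪ … ∪ T_k) ∪ f_k(T_1 ∪ … ∪ T_k). -/
open Classical in
/-- The elements of `A` comparable to `v`; they include `v` itself when `v ∈ A`. -/
noncomputable def comparables {α : Type*} [PartialOrder α] (A : Finset α) (v : α) : Finset α :=
  A.filter fun w => v ≤ w ∨ w ≤ v

theorem comparables_subset {α : Type*} [PartialOrder α] (A : Finset α) (v : α) :
    comparables A v ⊆ A := by
  classical exact Finset.filter_subset _ _

theorem mem_comparables_self {α : Type*} [PartialOrder α] {A : Finset α} {v : α} (hv : v ∈ A) :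
    v ∈ comparables A v := by
  classical exact Finset.mem_filter.2 ⟨hv, Or.inl le_rfl⟩

/-- Double counting of the ordered pairs of comparable elements. -/
theorem sum_card_comparables {α : Type*} [PartialOrder α] (A : Finset α) :
    ∑ v ∈ A, (comparables A v).card = A.card + 2 * compPairs A := by
  classical
  have hcomp : compPairs A = ((A ×ˢ A).filter fun p : α × α => p.1 < p.2).card := by
    rw [compPairs, ← Nat.card_eq_finsetCard]
    exact Nat.card_congr (Equiv.subtypeEquivRight fun p => by simp [and_assoc])
  have hlt : compPairs A = ∑ v ∈ A, ∑ w ∈ A, if v < w then 1 else 0 := by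
    rw [hcomp, Finset.card_filter, Finset.sum_product]
  have hgt : compPairs A = ∑ v ∈ A, ∑ w ∈ A, if w < v then 1 else 0 := by
    rw [hlt, Finset.sum_comm]
  have heq : A.card = ∑ v ∈ A, ∑ w ∈ A, if v = w then 1 else 0 := by
    simp
  calc ∑ v ∈ A, (comparables A v).card
      = ∑ v ∈ A, ∑ w ∈ A, ((if v = w then 1 else 0) + ((if v < w then 1 else 0) +
          if w < v then 1 else 0)) := by
        refine Finset.sum_congr rfl fun v _ => ?_
        rw [comparables, Finset.card_filter]
        refine Finset.sum_congr rfl fun w _ => ?_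
        rcases eq_or_ne v w with rfl | hne
        · simp
        · by_cases h : v < w
          · simp [hne, h, h.le, h.not_gt]
          · simp [hne, h, le_iff_lt_or_eq, hne.symm]
    _ = A.card + 2 * compPairs A := by
        simp only [Finset.sum_add_distrib]
        rw [← heq, ← hlt, ← hgt, two_mul]

/-- An element of a nonempty finite set comparable to as many elements of the set as possible. -/
noncomputable def maxComparable {α : Type*} [PartialOrder α] (A : Finset α) (hA : A.Nonempty) : α :=
  (A.exists_max_image (fun v => (comparables A v).card) hA).choose

theorem maxComparable_mem {α : Type*} [PartialOrder α] (A : Finset α) (hA : A.Nonempty) :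
    maxComparable A hA ∈ A :=
  (A.exists_max_image (fun v => (comparables A v).card) hA).choose_spec.1

theorem card_comparables_le_maxComparable {α : Type*} [PartialOrder α] (A : Finset α)
    (hA : A.Nonempty) {v : α} (hv : v ∈ A) :
    (comparables A v).card ≤ (comparables A (maxComparable A hA)).card :=
  (A.exists_max_image (fun v => (comparables A v).card) hA).choose_spec.2 v hv

theorem two_mul_add_one_le_card_comparables {α : Type*} [PartialOrder α] {A : Finset α}
    (hA : A.Nonempty) {d : ℕ} (hd : A.card * d ≤ compPairs A) :
    2 * d + 1 ≤ (comparables A (maxComparable A hA)).card := by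
  obtain ⟨v, hv, h⟩ := Finset.exists_le_of_sum_le (s := A) (f := fun _ => 2 * d + 1)
    (g := fun v => (comparables A v).card) hA (by
      rw [sum_card_comparables, Finset.sum_const, smul_eq_mul]
      linarith)
  exact h.trans (card_comparables_le_maxComparable A hA hv)

open Classical in
/-- One step of the Kleitman–Winston algorithm: the chosen vertex is removed, together with
everything comparable to it if it belongs to `I`. -/
noncomputable def containerStep {α : Type*} [PartialOrder α] (I A : Finset α)
    (hA : A.Nonempty) : Finset α :=
  if maxComparable A hA ∈ I then A \ comparables A (maxComparable A hA)
  else A.erase (maxComparable A hA)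

theorem containerStep_subset {α : Type*} [PartialOrder α] (I A : Finset α) (hA : A.Nonempty) :
    containerStep I A hA ⊆ A := by
  classical
  unfold containerStep
  split_ifs
  · exact Finset.sdiff_subset
  · exact Finset.erase_subset _ _

theorem maxComparable_notMem_containerStep {α : Type*} [PartialOrder α] (I A : Finset α)
    (hA : A.Nonempty) : maxComparable A hA ∉ containerStep I A hA := by
  classical
  unfold containerStep
  split_ifs
  · exact fun h => (Finset.mem_sdiff.1 h).2 (mem_comparables_self (maxComparable_mem A hA))
  · exact Finset.notMem_erase _ _

theorem containerStep_ssubset {α : Type*} [PartialOrder α] (I A : Finset α)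
    (hA : A.Nonempty) : containerStep I A hA ⊂ A :=
  Finset.ssubset_iff_subset_ne.2 ⟨containerStep_subset I A hA, fun h =>
    maxComparable_notMem_containerStep I A hA (h.symm ▸ maxComparable_mem A hA)⟩

/-- The Kleitman–Winston algorithm started from `A`, run until at most `t` vertices remain. -/
noncomputable def container {α : Type*} [PartialOrder α] (t : ℕ) (I A : Finset α) : Finset α :=
  if h : t < A.card then
    container t I (containerStep I A (Finset.card_pos.1 (Nat.zero_lt_of_lt h)))
  else A
termination_by A.card
decreasing_by exact Finset.card_lt_card (containerStep_ssubset _ _ _)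

theorem container_of_card_le {α : Type*} [PartialOrder α] {t : ℕ} {A : Finset α} (I : Finset α)
    (h : A.card ≤ t) : container t I A = A := by
  rw [container, dif_neg h.not_gt]

theorem container_of_lt_card {α : Type*} [PartialOrder α] {t : ℕ} {A : Finset α} (I : Finset α)
    (h : t < A.card) :
    container t I A =
      container t I (containerStep I A (Finset.card_pos.1 (Nat.zero_lt_of_lt h))) := by
  rw [container, dif_pos h]

theorem card_container_le {α : Type*} [PartialOrder α] (t : ℕ) (I A : Finset α) :
    (container t I A).card ≤ t := by
  induction A using Finset.strongInduction with
  | H A ih =>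
    by_cases h : t < A.card
    · rw [container_of_lt_card I h]
      exact ih _ (containerStep_ssubset _ _ _)
    · rw [container_of_card_le I (not_lt.1 h)]
      exact not_lt.1 h

theorem container_subset {α : Type*} [PartialOrder α] (t : ℕ) (I A : Finset α) :
    container t I A ⊆ A := by
  induction A using Finset.strongInduction with
  | H A ih =>
    by_cases h : t < A.card
    · rw [container_of_lt_card I h]
      exact (ih _ (containerStep_ssubset _ _ _)).trans (containerStep_subset _ _ _)
    · rw [container_of_card_le I (not_lt.1 h)]

theorem container_container {α : Type*} [PartialOrder α] {t s : ℕ} (hts : t ≤ s)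
    (I A : Finset α) : container t I (container s I A) = container t I A := by
  induction A using Finset.strongInduction with
  | H A ih =>
    by_cases h : s < A.card
    · rw [container_of_lt_card I h, container_of_lt_card I (hts.trans_lt h)]
      exact ih _ (containerStep_ssubset _ _ _)
    · rw [container_of_card_le I (not_lt.1 h)]

/-- The output only depends on which of the removed vertices lie in `I`. -/
theorem container_congr {α : Type*} [PartialOrder α] {t : ℕ} {I J A : Finset α}
    (hIJ : ∀ x ∈ A, x ∉ container t I A → (x ∈ J ↔ x ∈ I)) :
    container t J A = container t I A := by
  induction A using Finset.strongInduction with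
  | H A ih =>
    by_cases h : t < A.card
    · have hA : A.Nonempty := Finset.card_pos.1 (Nat.zero_lt_of_lt h)
      rw [container_of_lt_card I h] at hIJ ⊢
      rw [container_of_lt_card J h]
      have hv : maxComparable A hA ∈ J ↔ maxComparable A hA ∈ I :=
        hIJ _ (maxComparable_mem A hA) fun hmem =>
          maxComparable_notMem_containerStep I A hA (container_subset _ _ _ hmem)
      have hstep : containerStep J A hA = containerStep I A hA := by
        classical rw [containerStep, containerStep, if_congr hv rfl rfl]
      rw [hstep]
      exact ih _ (containerStep_ssubset _ _ _) fun x hx =>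
        hIJ x (containerStep_subset _ _ _ hx)
    · rw [container_of_card_le I (not_lt.1 h), container_of_card_le J (not_lt.1 h)]

theorem card_inter_sdiff_containerStep_mul_le {α : Type*} [PartialOrder α] [DecidableEq α]
    {I A : Finset α} {d : ℕ} (hI : IsAntichain (· ≤ ·) (I : Set α)) (hA : A.Nonempty)
    (hd : A.card * d ≤ compPairs A) :
    (I ∩ (A \ containerStep I A hA)).card * (2 * d + 1) ≤ (A \ containerStep I A hA).card := by
  by_cases hv : maxComparable A hA ∈ I
  · have hstep : A \ containerStep I A hA = comparables A (maxComparable A hA) := by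
      ext x
      have := @comparables_subset _ _ A (maxComparable A hA) x
      simp only [containerStep, if_pos hv, Finset.mem_sdiff]
      tauto
    have hone : (I ∩ comparables A (maxComparable A hA)).card ≤ 1 := by
      refine (Finset.card_le_card (t := {maxComparable A hA}) fun x hx => ?_).trans (by simp)
      simp only [comparables, Finset.mem_inter, Finset.mem_filter] at hx
      rw [Finset.mem_singleton]
      rcases hx.2.2 with h | h
      · exact (hI.eq hv hx.1 h).symm
      · exact hI.eq hx.1 hv h
    rw [hstep]
    calc _ ≤ 1 * (2 * d + 1) := Nat.mul_le_mul_right _ hone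
      _ ≤ _ := by simpa using two_mul_add_one_le_card_comparables hA hd
  · have hempty : I ∩ (A \ containerStep I A hA) = ∅ := by
      ext x
      simp only [containerStep, if_neg hv, Finset.mem_inter, Finset.mem_sdiff, Finset.mem_erase,
        Finset.notMem_empty, iff_false]
      rintro ⟨hxI, hxA, hx⟩
      exact hx ⟨fun h => hv (h ▸ hxI), hxA⟩
    simp [hempty]

theorem card_inter_sdiff_container_mul_le {α : Type*} [PartialOrder α] [DecidableEq α]
    {I : Finset α} {d t : ℕ} (hI : IsAntichain (· ≤ ·) (I : Set α))
    (hsat : ∀ S : Finset α, t < S.card → S.card * d ≤ compPairs S) (A : Finset α) :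
    (I ∩ (A \ container t I A)).card * (2 * d + 1) ≤ (A \ container t I A).card := by
  induction A using Finset.strongInduction with
  | H A ih =>
    by_cases h : t < A.card
    · have hA : A.Nonempty := Finset.card_pos.1 (Nat.zero_lt_of_lt h)
      rw [container_of_lt_card I h]
      set B := containerStep I A hA
      have hBA : B ⊆ A := containerStep_subset I A hA
      have hCB : container t I B ⊆ B := container_subset t I B
      have hsplit : A \ container t I B = (A \ B) ∪ (B \ container t I B) := by
        ext x
        have := @hBA x
        have := @hCB x
        simp only [Finset.mem_union, Finset.mem_sdiff]
        tauto
      have hdisj : Disjoint (A \ B) (B \ container t I B) :=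
        Finset.disjoint_left.2 fun x hx hx' =>
          (Finset.mem_sdiff.1 hx).2 (Finset.mem_sdiff.1 hx').1
      rw [hsplit, Finset.inter_union_distrib_left, Finset.card_union_of_disjoint hdisj,
        Finset.card_union_of_disjoint
          (hdisj.mono Finset.inter_subset_right Finset.inter_subset_right), add_mul]
      exact Nat.add_le_add (card_inter_sdiff_containerStep_mul_le hI hA (hsat A h))
        (ih B (containerStep_ssubset I A hA))
    · simp [container_of_card_le I (not_lt.1 h)]

/-- Multi-stage container lemma for antichains in a finite poset.  The parameters
`d 1 > d 2 > ⋯ > d k` and `m 0 > m 1 > ⋯ > m k` are positive integers (the values of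
`d`, `m` outside these index ranges are irrelevant). -/
theorem multiStageContainerLemma {α : Type*} [PartialOrder α] [Fintype α] [DecidableEq α]
    (k : ℕ) (hk : 1 ≤ k) (d m : ℕ → ℕ)
    (hdpos : ∀ j, 1 ≤ j → j ≤ k → 0 < d j)
    (hddec : ∀ j, 1 ≤ j → j < k → d (j + 1) < d j)
    (hmpos : ∀ j, j ≤ k → 0 < m j)
    (hmdec : ∀ j, j < k → m (j + 1) < m j)
    (hm0 : m 0 = Fintype.card α)
    (hsat : ∀ j, 1 ≤ j → j ≤ k →
      ∀ S : Finset α, m j < S.card → S.card * d j ≤ compPairs S) :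
    ∃ f : ℕ → Finset α → Finset α,
      (∀ j, 1 ≤ j → j ≤ k → ∀ T : Finset α,
        (T.card : ℝ) ≤ ∑ r ∈ Finset.Icc 1 j, (m (r - 1) : ℝ) / (2 * d r + 1) →
        (f j T).card ≤ m j) ∧
      ∀ I : Finset α, IsAntichain (· ≤ ·) (I : Set α) →
        ∃ T : ℕ → Finset α,
          (∀ j, 1 ≤ j → j ≤ k → T j ⊆ I) ∧
          (∀ i j, 1 ≤ i → i < j → j ≤ k → Disjoint (T i) (T j)) ∧
          (∀ j, 1 ≤ j → j ≤ k → ((T j).card : ℝ) ≤ (m (j - 1) : ℝ) / (2 * d j + 1)) ∧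
          (∀ j, 2 ≤ j → j ≤ k - 1 →
            T j ⊆ f (j - 1) ((Finset.Icc 1 (j - 1)).biUnion T)) ∧
          (∀ j, 1 ≤ j → j ≤ k →
            ((Finset.Icc 1 j).biUnion T) ∩ f j ((Finset.Icc 1 j).biUnion T) = ∅) ∧
          I ⊆ ((Finset.Icc 1 k).biUnion T) ∪ f k ((Finset.Icc 1 k).biUnion T) := by
  have hanti : ∀ i j, i ≤ j → j ≤ k → m j ≤ m i := by
    intro i j hij
    induction j, hij using Nat.le_induction with
    | base => exact fun _ => le_rfl
    | succ j _ ih => exact fun hj => (hmdec j hj).le.trans (ih (by omega))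
  refine ⟨fun j T => container (m j) T Finset.univ, fun j _ _ T _ => card_container_le _ _ _, ?_⟩
  intro I hI
  set C : ℕ → Finset α := fun j => container (m j) I Finset.univ
  have hCzero : C 0 = Finset.univ := container_of_card_le _ hm0.ge
  have hCC : ∀ i j, i ≤ j → j ≤ k → C j = container (m j) I (C i) := fun i j hij hj =>
    (container_container (hanti i j hij hj) I Finset.univ).symm
  have hCsub : ∀ i j, i ≤ j → j ≤ k → C j ⊆ C i := fun i j hij hj => by
    rw [hCC i j hij hj]
    exact container_subset _ _ _
  have hunion : ∀ j, j ≤ k →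
      (Finset.Icc 1 j).biUnion (fun i => I ∩ (C (i - 1) \ C i)) = I \ C j := by
    intro j
    induction j with
    | zero => simp [hCzero, Finset.sdiff_eq_empty_iff_subset.2 (Finset.subset_univ I)]
    | succ j ih =>
      intro hj
      rw [← Finset.insert_Icc_right_eq_Icc_add_one (by omega), Finset.biUnion_insert,
        ih (by omega)]
      ext x
      have := @hCsub j (j + 1) (by omega) hj x
      simp only [Finset.mem_union, Finset.mem_inter, Finset.mem_sdiff, Nat.add_sub_cancel]
      tauto
  have hf : ∀ j, container (m j) (I \ C j) Finset.univ = C j := fun j =>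
    container_congr fun x _ hx => by
      rw [Finset.mem_sdiff]
      exact and_iff_left hx
  refine ⟨fun j => I ∩ (C (j - 1) \ C j), fun j _ _ => Finset.inter_subset_left,
    ?_, ?_, ?_, ?_, ?_⟩
  · intro i j _ hij hj
    refine Finset.disjoint_left.2 fun x hxi hxj => ?_
    simp only [Finset.mem_inter, Finset.mem_sdiff] at hxi hxj
    exact hxi.2.2 (hCsub i (j - 1) (by omega) (by omega) hxj.2.1)
  · intro j hj hjk
    have hcard := card_inter_sdiff_container_mul_le hI (hsat j hj hjk) (C (j - 1))
    rw [← hCC (j - 1) j (by omega) hjk] at hcard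
    have hle : (C (j - 1) \ C j).card ≤ m (j - 1) :=
      (Finset.card_le_card Finset.sdiff_subset).trans (card_container_le _ _ _)
    rw [le_div_iff₀ (by positivity)]
    exact_mod_cast hcard.trans hle
  · intro j hj hjk
    simp only [hunion (j - 1) (by omega), hf]
    exact Finset.inter_subset_right.trans Finset.sdiff_subset
  · intro j _ hjk
    simp only [hunion j hjk, hf]
    exact Finset.sdiff_inter_self _ _
  · simp only [hunion k le_rfl, hf]
    intro x hx
    by_cases hxC : x ∈ C k <;> simp [hx, hxC]
end

section
/- Let n ≥ 2. For all integers i and s with 1 ≤ i ≤ n−1 and 0 ≤ s < i/2, the rational numbers defined below satisfy w'_{i,s} < w_{i,s}. -/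
/-- The number of coordinates of `x : {0,1,2}^n` equal to `2`. -/
def twos {n : ℕ} (x : Fin n → Fin 3) : ℕ :=
  (Finset.univ.filter fun j => x j = 2).card

/-- `|L_i^s|`: the number of elements of `L_i` with exactly `s` coordinates equal to `2`. -/
noncomputable def ellExact (n i s : ℕ) : ℕ :=
  Nat.card {x : Fin n → Fin 3 // ∑ j, (x j : ℕ) = i ∧ twos x = s}

/-- `|L_i^{≥ s}|`: the number of elements of `L_i` with at least `s` coordinates equal to `2`. -/
noncomputable def ellGe (n i s : ℕ) : ℕ :=
  Nat.card {x : Fin n → Fin 3 // ∑ j, (x j : ℕ) = i ∧ s ≤ twos x}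

/-- `|L_i^{≤ s}|` (with `s : ℤ`, so that `s = -1` gives the empty set): the number of
elements of `L_i` with at most `s` coordinates equal to `2`. -/
noncomputable def ellLe (n i : ℕ) (s : ℤ) : ℕ :=
  Nat.card {x : Fin n → Fin 3 // ∑ j, (x j : ℕ) = i ∧ (twos x : ℤ) ≤ s}

/-- The weight `w_{i,s}`. -/
noncomputable def wgt (n i s : ℕ) : ℚ :=
  ((ell n i : ℚ) * (ellGe n (i + 1) (s + 1) : ℚ)
      - (ell n (i + 1) : ℚ) * (ellGe n i (s + 1) : ℚ)) /
    ((ellExact n i s : ℚ) * (ell n i : ℚ) * (ell n (i + 1) : ℚ) * ((i : ℚ) - 2 * s))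

/-- The weight `w'_{i,s}`. -/
noncomputable def wgt' (n i s : ℕ) : ℚ :=
  ((ell n i : ℚ) * (ellLe n (i + 1) (s : ℤ) : ℚ)
      - (ell n (i + 1) : ℚ) * (ellLe n i ((s : ℤ) - 1) : ℚ)) /
    ((ellExact n i s : ℚ) * (ell n i : ℚ) * (ell n (i + 1) : ℚ) * ((n : ℚ) - (i : ℚ) + (s : ℚ)))

open Finset

lemma sum_val_eq_card_add_two_mul_twos {n : ℕ} (x : Fin n → Fin 3) :
    ∑ j, (x j : ℕ) = #{j | x j = 1} + 2 * twos x := by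
  rw [twos, card_filter, card_filter, mul_sum, ← sum_add_distrib]
  refine sum_congr rfl fun j _ => ?_
  generalize x j = y
  fin_cases y <;> simp

lemma two_mul_twos_le_sum {n : ℕ} (x : Fin n → Fin 3) : 2 * twos x ≤ ∑ j, (x j : ℕ) := by
  rw [sum_val_eq_card_add_two_mul_twos]; omega

lemma ellExact_eq_zero {n i s : ℕ} (h : i < 2 * s) : ellExact n i s = 0 := by
  rw [ellExact, Nat.card_eq_zero]
  left
  refine ⟨fun ⟨x, hx, hs⟩ => ?_⟩
  have := two_mul_twos_le_sum x
  omega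

/-- Choose the coordinates equal to `2`, then those equal to `1`. -/
lemma ellExact_add_two_mul (n u s : ℕ) :
    ellExact n (u + 2 * s) s = n.choose s * (n - s).choose u := by
  classical
  have hcard : #((powersetCard s (univ : Finset (Fin n))).sigma
      fun S => powersetCard u (univ \ S)) = n.choose s * (n - s).choose u := by
    rw [card_sigma, sum_congr rfl (g := fun _ => (n - s).choose u)]
    · simp
    · intro S hS
      rw [mem_powersetCard] at hS
      rw [card_powersetCard, card_sdiff_of_subset hS.1, hS.2]
      simp
  rw [ellExact, Nat.card_eq_fintype_card, Fintype.card_subtype, ← hcard]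
  refine card_nbij' (fun x => ⟨univ.filter (x · = 2), univ.filter (x · = 1)⟩)
    (fun p j => if j ∈ p.1 then 2 else if j ∈ p.2 then 1 else 0) ?_ ?_ ?_ ?_
  · intro x hx
    simp only [coe_filter, mem_univ, true_and, Set.mem_ofPred_eq] at hx
    have h := sum_val_eq_card_add_two_mul_twos x
    simp only [coe_sigma, Set.mem_sigma_iff, mem_coe, mem_powersetCard, subset_univ, true_and]
    refine ⟨hx.2, ?_, by omega⟩
    intro j hj
    simp_all
  · rintro ⟨S, U⟩ hp
    simp only [coe_sigma, Set.mem_sigma_iff, mem_coe, mem_powersetCard, subset_univ,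
      true_and] at hp
    obtain ⟨hS, hU, hUc⟩ := hp
    have hd : ∀ j ∈ S, j ∉ U := fun j hj hU' => by simpa [hj] using hU hU'
    set x : Fin n → Fin 3 := fun j => if j ∈ S then 2 else if j ∈ U then 1 else 0 with hx
    have h2 : univ.filter (x · = 2) = S := by
      ext j; simp only [hx, mem_filter, mem_univ, true_and]; split_ifs <;> simp_all
    have h1 : univ.filter (x · = 1) = U := by
      ext j; simp only [hx, mem_filter, mem_univ, true_and]; split_ifs <;> simp_all
    have h := sum_val_eq_card_add_two_mul_twos x
    have ht : twos x = s := by rw [twos, h2, hS]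
    simp only [coe_filter, mem_univ, true_and, Set.mem_ofPred_eq]
    exact ⟨by rw [h, h1, ht, hUc], ht⟩
  · intro x _
    funext j
    simp only [mem_filter, mem_univ, true_and]
    generalize x j = y
    fin_cases y <;> simp
  · rintro ⟨S, U⟩ hp
    simp only [coe_sigma, Set.mem_sigma_iff, mem_coe, mem_powersetCard, subset_univ,
      true_and] at hp
    have hd : ∀ j ∈ S, j ∉ U := fun j hj hU' => by simpa [hj] using hp.2.1 hU'
    simp only [Sigma.mk.injEq, heq_eq_eq]
    constructor <;> ext j <;> simp only [mem_filter, mem_univ, true_and] <;>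
      split_ifs <;> simp_all

lemma ellExact_pos {n i s : ℕ} (hs : 2 * s ≤ i) (hi : i ≤ n + s) : 0 < ellExact n i s := by
  obtain ⟨u, rfl⟩ := Nat.exists_eq_add_of_le' hs
  rw [ellExact_add_two_mul]
  exact Nat.mul_pos (Nat.choose_pos (by omega)) (Nat.choose_pos (by omega))

/-- Double counting of the pairs `x < y` with `x ∈ L_i^s`, `y ∈ L_{i+1}^s`. -/
lemma ellExact_mul_sub_add (n i s : ℕ) (hi : i ≤ n) :
    (ellExact n i s : ℚ) * ((n : ℚ) - i + s) = ellExact n (i + 1) s * ((i : ℚ) + 1 - 2 * s) := by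
  rcases lt_or_ge i (2 * s) with h | h
  · rw [ellExact_eq_zero h]
    rcases eq_or_lt_of_le (Nat.succ_le_of_lt h) with h' | h'
    · have : (i : ℚ) + 1 = 2 * s := mod_cast h'
      simp [this]
    · simp [ellExact_eq_zero h']
  · obtain ⟨u, rfl⟩ := Nat.exists_eq_add_of_le' h
    rw [show u + 2 * s + 1 = (u + 1) + 2 * s by ring, ellExact_add_two_mul, ellExact_add_two_mul]
    have := Nat.choose_succ_right_eq (n - s) u
    obtain ⟨v, rfl⟩ := Nat.exists_eq_add_of_le (show s + u ≤ n by omega)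
    rw [show s + u + v - s - u = v by omega] at this
    have : (((s + u + v - s).choose (u + 1) : ℕ) : ℚ) * (u + 1)
      = ((s + u + v - s).choose u : ℕ) * v := mod_cast this
    push_cast
    linear_combination -((s + u + v).choose s : ℚ) * this

/-- Double counting of the pairs `x < y` with `x ∈ L_i^s`, `y ∈ L_{i+1}^{s+1}`. -/
lemma ellExact_mul_sub_two_mul (n i s : ℕ) (hi : i ≤ n) :
    (ellExact n i s : ℚ) * ((i : ℚ) - 2 * s) = ellExact n (i + 1) (s + 1) * ((s : ℚ) + 1) := by
  rcases lt_trichotomy i (2 * s) with h | h | h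
  · rw [ellExact_eq_zero h, ellExact_eq_zero (by omega)]; simp
  · rw [ellExact_eq_zero (n := n) (i := i + 1) (s := s + 1) (by omega), h]; simp
  · obtain ⟨u, rfl⟩ := Nat.exists_eq_add_of_lt h
    rw [show 2 * s + u + 1 + 1 = u + 2 * (s + 1) by ring,
      show 2 * s + u + 1 = (u + 1) + 2 * s by ring, ellExact_add_two_mul, ellExact_add_two_mul]
    obtain ⟨m, rfl⟩ := Nat.exists_eq_add_of_le (show s + 1 ≤ n by omega)
    have h1 := Nat.choose_succ_right_eq (s + 1 + m) s
    have h2 := Nat.add_one_mul_choose_eq m u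
    rw [show s + 1 + m - s = m + 1 by omega] at *
    rw [show s + 1 + m - (s + 1) = m by omega]
    have h1' : ((s + 1 + m).choose (s + 1) : ℚ) * (s + 1) = (s + 1 + m).choose s * (m + 1) :=
      mod_cast h1
    have h2' : ((m : ℚ) + 1) * m.choose u = (m + 1).choose (u + 1) * (u + 1) := mod_cast h2
    push_cast
    linear_combination -((s + 1 + m).choose s : ℚ) * h2' - (m.choose u : ℚ) * h1'

lemma card_twos_eq_sum_ellExact (n i N : ℕ) (hN : i ≤ N) (p : ℕ → Prop) [DecidablePred p] :
    Nat.card {x : Fin n → Fin 3 // ∑ j, (x j : ℕ) = i ∧ p (twos x)}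
      = ∑ t ∈ (range (N + 1)).filter p, ellExact n i t := by
  classical
  rw [Nat.card_eq_fintype_card, Fintype.card_subtype,
    card_eq_sum_card_fiberwise (f := twos) (t := (range (N + 1)).filter p)]
  · refine sum_congr rfl fun t ht => ?_
    rw [ellExact, Nat.card_eq_fintype_card, Fintype.card_subtype, filter_filter]
    congr 1
    ext x
    simp only [mem_filter, mem_univ, true_and] at ht ⊢
    constructor
    · rintro ⟨⟨h1, _⟩, h2⟩; exact ⟨h1, h2⟩
    · rintro ⟨h1, h2⟩; exact ⟨⟨h1, h2 ▸ ht.2⟩, h2⟩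
  · intro x hx
    have := two_mul_twos_le_sum x
    simp only [coe_filter, mem_univ, true_and, Set.mem_ofPred_eq, mem_range] at hx ⊢
    exact ⟨by omega, hx.2⟩

lemma ell_eq_sum (n i N : ℕ) (hN : i ≤ N) :
    ell n i = ∑ t ∈ range (N + 1), ellExact n i t := by
  simpa [ell] using card_twos_eq_sum_ellExact n i N hN fun _ => True

lemma ellGe_eq_sum (n i s N : ℕ) (hN : i ≤ N) :
    ellGe n i s = ∑ t ∈ Ico s (N + 1), ellExact n i t := by
  rw [ellGe, card_twos_eq_sum_ellExact n i N hN fun t => s ≤ t]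
  congr 1; ext t; simp only [mem_filter, mem_range, mem_Ico]; omega

lemma ellLe_sub_one_eq_sum (n i s : ℕ) :
    ellLe n i ((s : ℤ) - 1) = ∑ t ∈ range s, ellExact n i t := by
  rw [ellLe, card_twos_eq_sum_ellExact n i (i + s) (by omega) fun t => (t : ℤ) ≤ (s : ℤ) - 1]
  congr 1; ext t; simp only [mem_filter, mem_range]; omega

/-- For uniformly distributed `x ∈ L_i`, the probability that a uniformly random upper cover of
`x` equals a given element of `L_{i+1}^t`, up to the factor `|L_i|`. -/
def coverWeight (n i t : ℕ) : ℚ :=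
  ((i : ℚ) + 1 - 2 * t) / (n - t) + t / (n - t + 1)

lemma coverWeight_lt {n i t t' : ℕ} (hi : i + 1 ≤ n) (ht : t < t') (ht' : t' < n) :
    coverWeight n i t' < coverWeight n i t := by
  obtain ⟨q, rfl⟩ := Nat.exists_eq_add_of_lt ht'
  obtain ⟨d, rfl⟩ := Nat.exists_eq_add_of_lt ht
  obtain ⟨k, hk⟩ := Nat.exists_eq_add_of_le hi
  have hk : (t : ℚ) + d + 1 + q + 1 = i + 1 + k := mod_cast hk
  rw [← sub_pos]
  have e : coverWeight (t + d + 1 + q + 1) i t - coverWeight (t + d + 1 + q + 1) i (t + d + 1)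
    = ((d : ℚ) + 1) * (((t + d + q + 2) + k) * ((q + d + 3) * (q + 2))
        - (t + d + q + 3) * ((q + d + 2) * (q + 1)))
      / ((q + d + 2) * (q + 1) * (q + d + 3) * (q + 2)) := by
    have hi' : (i : ℚ) = t + d + 1 + q - k := by linarith
    simp only [coverWeight]
    rw [hi']
    push_cast
    rw [show (t : ℚ) + d + 1 + q + 1 - t = q + d + 2 by ring,
      show (t : ℚ) + d + 1 + q + 1 - (t + d + 1) = q + 1 by ring]
    field_simp
    ring
  rw [e]
  refine div_pos (mul_pos (by positivity) ?_) (by positivity)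
  have : ((t : ℚ) + d + q + 2 + k) * ((q + d + 3) * (q + 2))
      - (t + d + q + 3) * ((q + d + 2) * (q + 1))
      = k * ((q + d + 3) * (q + 2)) + (t + d + q + 2) * (q + 2)
        + (t + d + 1) * (q + d + 2) := by ring
  rw [this]
  positivity

/-- The random upper covers land in `L_{i+1}^{≤ N}` exactly when they start in `L_i^{≤ N}` and do
not raise a `1` of an element of `L_i^N`. -/
lemma sum_ellExact_mul_coverWeight {n i : ℕ} (hi : i + 1 ≤ n) (N : ℕ) :
    ∑ t ∈ range (N + 1), (ellExact n (i + 1) t : ℚ) * coverWeight n i t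
      = ∑ t ∈ range (N + 1), (ellExact n i t : ℚ)
        - ellExact n i N * ((i : ℚ) - 2 * N) / (n - N) := by
  have hstay : ∀ t : ℕ, (ellExact n (i + 1) t : ℚ) * (((i : ℚ) + 1 - 2 * t) / (n - t))
      = ellExact n i t - ellExact n i t * ((i : ℚ) - 2 * t) / (n - t) := by
    intro t
    rw [← mul_div_assoc, ← ellExact_mul_sub_add n i t (by omega)]
    rcases lt_or_ge i (2 * t) with h | h
    · simp [ellExact_eq_zero h]
    · have : (n : ℚ) - t ≠ 0 := by
        have : (t : ℚ) < n := by exact_mod_cast (show t < n by omega)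
        linarith
      field_simp
      ring
  induction N with
  | zero =>
    have := hstay 0
    simp only [zero_add, sum_range_one, coverWeight, mul_add, this]
    simp
  | succ N ih =>
    rw [sum_range_succ, ih, sum_range_succ _ (N + 1), coverWeight, mul_add, hstay,
      ellExact_mul_sub_two_mul n i N (by omega)]
    push_cast
    rw [show (n : ℚ) - (N + 1) + 1 = n - N by ring]
    ring

/-- Uniform measure on `L_{i+1}` strictly dominates the distribution of random upper covers. -/
lemma sum_mul_sum_coverWeight_lt {n i s : ℕ} (hi : i + 1 ≤ n) (hs : 2 * s < i) :
    (∑ t ∈ Ico (s + 1) (i + 2), (ellExact n (i + 1) t : ℚ) * coverWeight n i t)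
        * ∑ t ∈ range (s + 1), (ellExact n (i + 1) t : ℚ)
      < (∑ t ∈ Ico (s + 1) (i + 2), (ellExact n (i + 1) t : ℚ))
        * ∑ t ∈ range (s + 1), (ellExact n (i + 1) t : ℚ) * coverWeight n i t := by
  have hpos : ∀ t, 2 * t ≤ i + 1 → (0 : ℚ) < ellExact n (i + 1) t := fun t ht =>
    Nat.cast_pos.2 (ellExact_pos ht (by omega))
  have hX : (0 : ℚ) < ∑ t ∈ range (s + 1), (ellExact n (i + 1) t : ℚ) :=
    sum_pos (fun t ht => hpos t (by rw [mem_range] at ht; omega)) (by simp)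
  have hGX : (∑ t ∈ range (s + 1), (ellExact n (i + 1) t : ℚ)) * coverWeight n i s
      ≤ ∑ t ∈ range (s + 1), (ellExact n (i + 1) t : ℚ) * coverWeight n i t := by
    rw [sum_mul]
    refine sum_le_sum fun t ht => mul_le_mul_of_nonneg_left ?_ (Nat.cast_nonneg _)
    rcases eq_or_lt_of_le (Nat.lt_succ_iff.1 (mem_range.1 ht)) with rfl | h
    · rfl
    · exact (coverWeight_lt hi h (by omega)).le
  have hGY : ∑ t ∈ Ico (s + 1) (i + 2), (ellExact n (i + 1) t : ℚ) * coverWeight n i t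
      < (∑ t ∈ Ico (s + 1) (i + 2), (ellExact n (i + 1) t : ℚ)) * coverWeight n i s := by
    rw [sum_mul]
    refine sum_lt_sum (fun t ht => ?_) ⟨s + 1, by simp; omega, ?_⟩
    · rcases lt_or_ge (i + 1) (2 * t) with h | h
      · simp [ellExact_eq_zero h]
      · exact mul_le_mul_of_nonneg_left
          (coverWeight_lt hi (mem_Ico.1 ht).1 (by omega)).le (Nat.cast_nonneg _)
    · exact mul_lt_mul_of_pos_left (coverWeight_lt hi (by omega) (by omega))
        (hpos _ (by omega))
  have hY : (0 : ℚ) ≤ ∑ t ∈ Ico (s + 1) (i + 2), (ellExact n (i + 1) t : ℚ) :=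
    sum_nonneg fun t _ => Nat.cast_nonneg _
  calc _ < _ := mul_lt_mul_of_pos_right hGY hX
    _ = _ := by rw [mul_assoc, mul_comm (coverWeight n i s)]
    _ ≤ _ := mul_le_mul_of_nonneg_left hGX hY

/-- For `1 ≤ i ≤ n-1` and `0 ≤ s < i/2`, we have `w'_{i,s} < w_{i,s}`. -/
theorem wgt'_lt_wgt (n : ℕ) (hn : 2 ≤ n) (i s : ℕ)
    (hi1 : 1 ≤ i) (hi2 : i ≤ n - 1) (hs : 2 * s < i) :
    wgt' n i s < wgt n i s := by
  have hi : i + 1 ≤ n := by omega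
  have hδ := sum_mul_sum_coverWeight_lt hi hs
  have hGX := sum_ellExact_mul_coverWeight hi s
  have hG := sum_ellExact_mul_coverWeight hi (i + 1)
  rw [ellExact_eq_zero (show i < 2 * (i + 1) by omega)] at hG
  have hle : s + 1 ≤ i + 2 := by omega
  have hA := ell_eq_sum n i (i + 1) (by omega)
  have hB := ell_eq_sum n (i + 1) (i + 1) le_rfl
  have hBX : ellLe n (i + 1) (s : ℤ) = ∑ t ∈ range (s + 1), ellExact n (i + 1) t := by
    simpa using ellLe_sub_one_eq_sum n (i + 1) (s + 1)
  rw [wgt, wgt', ellGe_eq_sum n i (s + 1) (i + 1) (by omega),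
    ellGe_eq_sum n (i + 1) (s + 1) (i + 1) le_rfl, ellLe_sub_one_eq_sum, hBX]
  have hA0 : 0 < ell n i := by
    rw [hA]
    exact sum_pos' (fun _ _ => Nat.zero_le _) ⟨s, by simp; omega, ellExact_pos hs.le (by omega)⟩
  have hB0 : 0 < ell n (i + 1) := by
    rw [hB]
    exact sum_pos' (fun _ _ => Nat.zero_le _) ⟨s, by simp; omega, ellExact_pos (by omega) (by omega)⟩
  have ha0 : 0 < ellExact n i s := ellExact_pos hs.le (by omega)
  rw [← sum_range_add_sum_Ico _ hle, sum_range_succ] at hA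
  rw [← sum_range_add_sum_Ico _ hle] at hB
  rw [← sum_range_add_sum_Ico _ hle, ← sum_range_add_sum_Ico (fun t => (ellExact n i t : ℚ)) hle,
    sum_range_succ (fun t => (ellExact n i t : ℚ))] at hG
  rw [sum_range_succ (fun t => (ellExact n i t : ℚ))] at hGX
  have hA' := congrArg (Nat.cast (R := ℚ)) hA
  have hB' := congrArg (Nat.cast (R := ℚ)) hB
  push_cast at hA' hB' ⊢
  have hU : (0 : ℚ) < i - 2 * s := by
    have : (2 : ℚ) * s < i := mod_cast hs
    linarith
  have hV : (0 : ℚ) < n - i + s := by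
    have : (i : ℚ) + 1 ≤ n := mod_cast hi
    have : (0 : ℚ) ≤ s := Nat.cast_nonneg s
    linarith
  have hns : (n : ℚ) - s = (i - 2 * s) + (n - i + s) := by ring
  rw [hns] at hGX
  have hA0' : (0 : ℚ) < ell n i := mod_cast hA0
  have hB0' : (0 : ℚ) < ell n (i + 1) := mod_cast hB0
  have ha0' : (0 : ℚ) < ellExact n i s := mod_cast ha0
  generalize (i : ℚ) - 2 * s = U at *
  generalize (n : ℚ) - i + s = V at *
  generalize (ell n i : ℚ) = A at *
  generalize (ell n (i + 1) : ℚ) = B at *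
  generalize (ellExact n i s : ℚ) = a at *
  generalize ∑ t ∈ range (s + 1), (ellExact n (i + 1) t : ℚ) * coverWeight n i t = GX at *
  generalize ∑ t ∈ Ico (s + 1) (i + 2), (ellExact n (i + 1) t : ℚ) * coverWeight n i t = GY at *
  generalize ∑ t ∈ range (s + 1), (ellExact n (i + 1) t : ℚ) = X at *
  generalize ∑ t ∈ Ico (s + 1) (i + 2), (ellExact n (i + 1) t : ℚ) = Y at *
  generalize ∑ t ∈ range s, (ellExact n i t : ℚ) = P at *
  generalize ∑ t ∈ Ico (s + 1) (i + 2), (ellExact n i t : ℚ) = Q at *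
  have hUV : U + V ≠ 0 := by positivity
  have hGX' : (U + V) * (P + a - GX) = a * U := by rw [hGX]; field_simp; ring
  have hG' : GX + GY = P + a + Q := by simpa using hG
  have hX : X = B - Y := by linarith
  have hGY : GY = A - GX := by linarith
  have hQ : Q = A - P - a := by linarith
  subst hX hGY hQ
  rw [div_lt_div_iff₀ (by positivity) (by positivity), ← sub_pos]
  have hδ' : 0 < Y * GX - (A - GX) * (B - Y) := by linarith
  have : 0 < (Y * GX - (A - GX) * (B - Y)) * (U + V) * (a * A * B) := by positivity
  refine this.trans_eq ?_
  linear_combination (-(a * A * B) * B) * hGX'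
end

section
/- Let n ≥ 5. For all integers i and s with 1 ≤ i ≤ n−1 and 0 ≤ s < i/2, the rational number w_{i,s} defined below satisfies w_{i,s} ≤ 2/((i+1)·|L_{i+1}|). -/
open Finset

/-- The number of coordinates of `x : {0,1,2}^n` equal to `a`. -/
def coordCount {n : ℕ} (x : Fin n → Fin 3) (a : Fin 3) : ℕ :=
  (univ.filter fun j => x j = a).card

theorem coordCount_two {n : ℕ} (x : Fin n → Fin 3) : coordCount x 2 = twos x := rfl

theorem sum_eq_coordCount {n : ℕ} (x : Fin n → Fin 3) :
    ∑ j, (x j : ℕ) = coordCount x 1 + 2 * twos x := by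
  simp only [coordCount, twos, card_filter, mul_sum, ← sum_add_distrib]
  refine sum_congr rfl fun j _ => ?_
  generalize x j = a
  fin_cases a <;> rfl

theorem coordCount_add_add {n : ℕ} (x : Fin n → Fin 3) :
    coordCount x 0 + coordCount x 1 + twos x = n := by
  have h : coordCount x 0 + coordCount x 1 + twos x = ∑ _j : Fin n, 1 := by
    simp only [coordCount, twos, card_filter, ← sum_add_distrib]
    refine sum_congr rfl fun j _ => ?_
    generalize x j = a
    fin_cases a <;> rfl
  simpa using h

theorem coordCount_update {n : ℕ} (x : Fin n → Fin 3) (j : Fin n) (a c : Fin 3) :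
    coordCount (Function.update x j a) c + (if x j = c then 1 else 0) =
      coordCount x c + (if a = c then 1 else 0) := by
  simp only [coordCount, card_filter]
  rw [← add_sum_erase _ _ (mem_univ j), ← add_sum_erase (univ : Finset (Fin n))
    (fun k => if x k = c then 1 else 0) (mem_univ j)]
  have h : ∑ k ∈ univ.erase j, (if Function.update x j a k = c then 1 else 0) =
      ∑ k ∈ univ.erase j, (if x k = c then 1 else 0) :=
    sum_congr rfl fun k hk => by rw [Function.update_of_ne (ne_of_mem_erase hk)]
  rw [h, Function.update_self]
  ring

/-- Double counting of the pairs related by changing one coordinate from `b` to `a`. -/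
theorem sum_coordCount_eq {n : ℕ} (a b : Fin 3) (S T : Finset (Fin n → Fin 3))
    (hST : ∀ x ∈ S, ∀ j, x j = a → Function.update x j b ∈ T)
    (hTS : ∀ y ∈ T, ∀ j, y j = b → Function.update y j a ∈ S) :
    ∑ x ∈ S, coordCount x a = ∑ y ∈ T, coordCount y b := by
  simp only [coordCount, ← card_sigma]
  refine card_bij' (fun p _ => ⟨Function.update p.1 p.2 b, p.2⟩)
    (fun p _ => ⟨Function.update p.1 p.2 a, p.2⟩) ?_ ?_ ?_ ?_
  · rintro ⟨x, j⟩ h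
    simp only [mem_sigma, mem_filter, mem_univ, true_and] at h ⊢
    exact ⟨hST x h.1 j h.2, Function.update_self ..⟩
  · rintro ⟨x, j⟩ h
    simp only [mem_sigma, mem_filter, mem_univ, true_and] at h ⊢
    exact ⟨hTS x h.1 j h.2, Function.update_self ..⟩
  · rintro ⟨x, j⟩ h
    simp only [mem_sigma, mem_filter, mem_univ, true_and] at h
    simp [← h.2]
  · rintro ⟨x, j⟩ h
    simp only [mem_sigma, mem_filter, mem_univ, true_and] at h
    simp [← h.2]

/-- `L_i^{≥ t}` as a finset. -/
def levelGe (n i t : ℕ) : Finset (Fin n → Fin 3) :=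
  univ.filter fun x => ∑ j, (x j : ℕ) = i ∧ t ≤ twos x

/-- `L_i^t` as a finset. -/
def levelExact (n i t : ℕ) : Finset (Fin n → Fin 3) :=
  univ.filter fun x => ∑ j, (x j : ℕ) = i ∧ twos x = t

theorem mem_levelGe {n i t : ℕ} {x : Fin n → Fin 3} :
    x ∈ levelGe n i t ↔ coordCount x 1 + 2 * coordCount x 2 = i ∧ t ≤ coordCount x 2 := by
  simp [levelGe, sum_eq_coordCount, coordCount_two]

theorem mem_levelExact {n i t : ℕ} {x : Fin n → Fin 3} :
    x ∈ levelExact n i t ↔ coordCount x 1 + 2 * coordCount x 2 = i ∧ coordCount x 2 = t := by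
  simp [levelExact, sum_eq_coordCount, coordCount_two]

theorem ellGe_eq_card (n i t : ℕ) : ellGe n i t = (levelGe n i t).card := by
  rw [ellGe, Nat.card_eq_fintype_card, Fintype.card_subtype, levelGe]

theorem ellExact_eq_card (n i t : ℕ) : ellExact n i t = (levelExact n i t).card := by
  rw [ellExact, Nat.card_eq_fintype_card, Fintype.card_subtype, levelExact]

theorem ell_eq_card (n i : ℕ) : ell n i = (levelGe n i 0).card := by
  simp [ell, Nat.card_eq_fintype_card, Fintype.card_subtype, levelGe]

theorem sum_coordCount_one_levelGe (n i t : ℕ) :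
    ∑ x ∈ levelGe n (i + 1) t, coordCount x 1 = ∑ y ∈ levelGe n i t, coordCount y 0 := by
  apply sum_coordCount_eq <;> intro x hx j hj <;> rw [mem_levelGe] at * <;>
  · have h1 := coordCount_update x j 0 1
    have h2 := coordCount_update x j 0 2
    have h3 := coordCount_update x j 1 1
    have h4 := coordCount_update x j 1 2
    simp [hj] at h1 h2 h3 h4
    omega

theorem sum_coordCount_two_levelGe (n i t : ℕ) :
    ∑ x ∈ levelGe n (i + 1) (t + 1), coordCount x 2 = ∑ y ∈ levelGe n i t, coordCount y 1 := by
  apply sum_coordCount_eq <;> intro x hx j hj <;> rw [mem_levelGe] at * <;>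
  · have h1 := coordCount_update x j 1 1
    have h2 := coordCount_update x j 1 2
    have h3 := coordCount_update x j 2 1
    have h4 := coordCount_update x j 2 2
    simp [hj] at h1 h2 h3 h4
    omega

theorem sum_coordCount_two_levelExact (n i t : ℕ) :
    ∑ x ∈ levelExact n (i + 1) (t + 1), coordCount x 2 =
      ∑ y ∈ levelExact n i t, coordCount y 1 := by
  apply sum_coordCount_eq <;> intro x hx j hj <;> rw [mem_levelExact] at * <;>
  · have h1 := coordCount_update x j 1 1
    have h2 := coordCount_update x j 1 2
    have h3 := coordCount_update x j 2 1
    have h4 := coordCount_update x j 2 2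
    simp [hj] at h1 h2 h3 h4
    omega

theorem ellExact_mul_sub (n i s : ℕ) :
    (ellExact n i s : ℚ) * ((i : ℚ) - 2 * s) = (s + 1) * ellExact n (i + 1) (s + 1) := by
  have h := congrArg (Nat.cast (R := ℚ)) (sum_coordCount_two_levelExact n i s)
  push_cast at h
  rw [sum_congr rfl (g := fun _ => (s : ℚ) + 1), sum_congr (s₁ := levelExact n i s) rfl
    (g := fun _ => (i : ℚ) - 2 * s)] at h
  · simp only [sum_const, nsmul_eq_mul, ← ellExact_eq_card] at h
    linarith
  · intro x hx
    rw [mem_levelExact] at hx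
    rw [← hx.1, ← hx.2]
    push_cast
    ring
  · intro x hx
    rw [(mem_levelExact.1 hx).2]
    push_cast
    ring

theorem sum_coordCount_two_split (n i t : ℕ) :
    ∑ x ∈ levelGe n i t, coordCount x 2 =
      t * ellExact n i t + ∑ x ∈ levelGe n i (t + 1), coordCount x 2 := by
  have hd : Disjoint (levelExact n i t) (levelGe n i (t + 1)) := by
    rw [disjoint_left]
    intro x hx hy
    rw [mem_levelExact] at hx
    rw [mem_levelGe] at hy
    omega
  have hu : levelGe n i t = (levelExact n i t).disjUnion (levelGe n i (t + 1)) hd := by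
    ext x
    rw [mem_disjUnion, mem_levelExact, mem_levelGe, mem_levelGe]
    omega
  rw [hu, sum_disjUnion, sum_congr (s₁ := levelExact n i t) rfl
    fun x hx => (mem_levelExact.1 hx).2]
  simp [ellExact_eq_card, mul_comm]

/-- Summing the up-degrees, weighted by the multiplicity of the lowered unit, over
`L_i^{≥ t}`. -/
theorem sum_levelGe_weight (n i t : ℕ) :
    ∑ y ∈ levelGe n i t, ((n : ℚ) + i - 3 * coordCount y 2) =
      (i + 1) * ellGe n (i + 1) t - 2 * t * ellExact n (i + 1) t := by
  have h0 : ∑ x ∈ levelGe n (i + 1) t, (coordCount x 1 + 2 * coordCount x 2) =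
      ellGe n (i + 1) t * (i + 1) := by
    rw [sum_congr rfl fun x hx => (mem_levelGe.1 hx).1, sum_const, ellGe_eq_card, smul_eq_mul]
  rw [sum_add_distrib, ← mul_sum, sum_coordCount_one_levelGe, sum_coordCount_two_split,
    sum_coordCount_two_levelGe] at h0
  have h1 : ∑ y ∈ levelGe n i t, ((n : ℚ) + i - 3 * coordCount y 2) =
      ∑ y ∈ levelGe n i t, ((coordCount y 0 : ℚ) + 2 * coordCount y 1) := by
    refine sum_congr rfl fun y hy => ?_
    have h2 := (mem_levelGe.1 hy).1
    have h3 := coordCount_add_add y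
    rw [← coordCount_two] at h3
    rw [← h2]
    nth_rw 1 [← h3]
    push_cast
    ring
  rw [h1, sum_add_distrib, ← mul_sum]
  have h4 := congrArg (Nat.cast (R := ℚ)) h0
  push_cast at h4
  linarith

/-- A Chebyshev-type inequality: if `f ≤ c` on `A ⊆ L` and `c ≤ f` on `L \ A`, then the mean
of `f` over `A` is at most its mean over `L`. -/
theorem card_mul_sum_le_of_threshold {α : Type*} [DecidableEq α] {A L : Finset α} (hAL : A ⊆ L)
    (f : α → ℚ) (c : ℚ) (hA : ∀ x ∈ A, f x ≤ c) (hL : ∀ x ∈ L \ A, c ≤ f x) :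
    (L.card : ℚ) * ∑ x ∈ A, f x ≤ A.card * ∑ x ∈ L, f x := by
  have h1 : ∑ x ∈ A, f x ≤ A.card * c := by simpa using sum_le_card_nsmul A f c hA
  have h2 : (L \ A).card * c ≤ ∑ x ∈ L \ A, f x := by
    simpa using card_nsmul_le_sum (L \ A) f c hL
  have h3 : (L.card : ℚ) = (L \ A).card + A.card := by
    exact_mod_cast (card_sdiff_add_card_eq_card hAL).symm
  rw [← sum_sdiff hAL, h3]
  nlinarith [mul_le_mul_of_nonneg_left h1 (Nat.cast_nonneg (α := ℚ) (L \ A).card),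
    mul_le_mul_of_nonneg_left h2 (Nat.cast_nonneg (α := ℚ) A.card)]

theorem ell_mul_ellGe_sub_le (n i t : ℕ) :
    (ell n i : ℚ) * ((i + 1) * ellGe n (i + 1) t - 2 * t * ellExact n (i + 1) t) ≤
      ellGe n i t * ((i + 1) * ell n (i + 1)) := by
  have h0 := sum_levelGe_weight n i 0
  simp only [Nat.cast_zero, mul_zero, zero_mul, sub_zero] at h0
  rw [ellGe_eq_card n (i + 1) 0, ← ell_eq_card] at h0
  rw [← sum_levelGe_weight, ← h0, ell_eq_card, ellGe_eq_card]
  refine card_mul_sum_le_of_threshold (fun x hx => ?_) _ ((n : ℚ) + i - 3 * t)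
    (fun x hx => ?_) (fun x hx => ?_)
  · exact mem_levelGe.2 ⟨(mem_levelGe.1 hx).1, Nat.zero_le _⟩
  · have h : (t : ℚ) ≤ coordCount x 2 := by exact_mod_cast (mem_levelGe.1 hx).2
    linarith
  · simp only [mem_sdiff, mem_levelGe] at hx
    have h : (coordCount x 2 : ℚ) ≤ t := by exact_mod_cast (by omega : coordCount x 2 ≤ t)
    linarith

/-- For `n ≥ 5`, `1 ≤ i ≤ n-1` and `0 ≤ s < i/2`, we have `w_{i,s} ≤ 2/((i+1)|L_{i+1}|)`. -/
theorem wgt_le (n : ℕ) (hn : 5 ≤ n) (i s : ℕ)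
    (hi1 : 1 ≤ i) (hi2 : i ≤ n - 1) (hs : 2 * s < i) :
    wgt n i s ≤ 2 / (((i : ℚ) + 1) * (ell n (i + 1) : ℚ)) := by
  have hi : (0 : ℚ) < (i : ℚ) + 1 := by positivity
  have hpos : (0 : ℚ) < (i : ℚ) - 2 * s := by
    have : (2 : ℚ) * s < i := by exact_mod_cast hs
    linarith
  rcases Nat.eq_zero_or_pos (ellExact n i s) with h | hE
  · simp only [wgt, h, Nat.cast_zero, zero_mul, div_zero]
    positivity
  rcases Nat.eq_zero_or_pos (ell n i) with h | hL
  · simp only [wgt, h, Nat.cast_zero, zero_mul, mul_zero, div_zero]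
    positivity
  rcases Nat.eq_zero_or_pos (ell n (i + 1)) with h | hM
  · simp [wgt, h]
  have hE' : (0 : ℚ) < ellExact n i s := by exact_mod_cast hE
  have hL' : (0 : ℚ) < ell n i := by exact_mod_cast hL
  have hM' : (0 : ℚ) < ell n (i + 1) := by exact_mod_cast hM
  have key := ell_mul_ellGe_sub_le n i (s + 1)
  have hx := ellExact_mul_sub n i s
  push_cast at key
  rw [wgt, div_le_div_iff₀ (by positivity) (by positivity)]
  calc _ = ell n (i + 1) * (ell n i * ((i + 1) * ellGe n (i + 1) (s + 1)) -
        ellGe n i (s + 1) * ((i + 1) * ell n (i + 1)) : ℚ) := by ring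
    _ ≤ ell n (i + 1) * (2 * ell n i * ((s + 1) * ellExact n (i + 1) (s + 1)) : ℚ) := by
        refine mul_le_mul_of_nonneg_left ?_ hM'.le
        linarith
    _ = _ := by rw [← hx]; ring
end

section
/- For all integers n ≥ 2 and 1 ≤ i ≤ n−1, we have (i+1)·ℓ_{i+1}(n) ≤ (n+i)·ℓ_i(n). -/
/-- The elements of `{0,1,2}^n` whose coordinates sum to `i`, as a finset. -/
def ellLevel (n i : ℕ) : Finset (Fin n → Fin 3) :=
  Finset.univ.filter fun x => ∑ j, (x j : ℕ) = i

theorem mem_ellLevel {n i : ℕ} {x : Fin n → Fin 3} :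
    x ∈ ellLevel n i ↔ ∑ j, (x j : ℕ) = i := by
  simp [ellLevel]

theorem ell_eq_card_ellLevel (n i : ℕ) : ell n i = (ellLevel n i).card := by
  rw [ell, Nat.card_eq_fintype_card, Fintype.card_subtype, ellLevel]

theorem sum_update_sub_one_add_one {n : ℕ} (y : Fin n → Fin 3) (j : Fin n) (hj : y j ≠ 0) :
    ∑ k, (Function.update y j (y j - 1) k : ℕ) + 1 = ∑ k, (y k : ℕ) := by
  rw [← Finset.add_sum_erase _ _ (Finset.mem_univ j),
    ← Finset.add_sum_erase _ (fun k => (y k : ℕ)) (Finset.mem_univ j)]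
  have hrest : ∑ k ∈ Finset.univ.erase j, (Function.update y j (y j - 1) k : ℕ) =
      ∑ k ∈ Finset.univ.erase j, (y k : ℕ) :=
    Finset.sum_congr rfl fun k hk => by
      rw [Function.update_of_ne (Finset.ne_of_mem_erase hk)]
  have hval : ∀ a : Fin 3, a ≠ 0 → ((a - 1 : Fin 3) : ℕ) + 1 = a := by decide
  have := hval (y j) hj
  rw [hrest, Function.update_self]
  omega

/-- Lowering the `j`-th coordinate by one injects the part of level `i + 1` where that coordinate
is nonzero into level `i`. -/
theorem sum_apply_ellLevel_succ_le (n i : ℕ) (j : Fin n) :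
    ∑ y ∈ ellLevel n (i + 1), (y j : ℕ) ≤ ∑ x ∈ ellLevel n i, ((x j : ℕ) + 1) := by
  have hinj : Set.InjOn (fun y : Fin n → Fin 3 => Function.update y j (y j - 1))
      ((ellLevel n (i + 1)).filter fun y => y j ≠ 0) := by
    intro y _ z _ h
    funext k
    have hk := congrFun h k
    by_cases hkj : k = j
    · subst hkj
      simpa using hk
    · simpa [hkj] using hk
  have hval : ∀ a : Fin 3, a ≠ 0 → (a : ℕ) = ((a - 1 : Fin 3) : ℕ) + 1 := by decide
  calc ∑ y ∈ ellLevel n (i + 1), (y j : ℕ)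
      = ∑ y ∈ (ellLevel n (i + 1)).filter (fun y => y j ≠ 0), (y j : ℕ) := by
        symm
        refine Finset.sum_filter_of_ne fun y _ h h0 => h ?_
        simp [h0]
    _ = ∑ x ∈ ((ellLevel n (i + 1)).filter (fun y => y j ≠ 0)).image
          (fun y => Function.update y j (y j - 1)), ((x j : ℕ) + 1) := by
        rw [Finset.sum_image hinj]
        refine Finset.sum_congr rfl fun y hy => ?_
        rw [Function.update_self]
        exact hval _ (Finset.mem_filter.mp hy).2
    _ ≤ ∑ x ∈ ellLevel n i, ((x j : ℕ) + 1) := by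
        refine Finset.sum_le_sum_of_subset fun x hx => ?_
        obtain ⟨y, hy, rfl⟩ := Finset.mem_image.mp hx
        obtain ⟨hy, hj⟩ := Finset.mem_filter.mp hy
        rw [mem_ellLevel] at hy ⊢
        have := sum_update_sub_one_add_one y j hj
        omega

/-- For `n ≥ 2` and `1 ≤ i ≤ n-1`, `(i+1) ℓ_{i+1}(n) ≤ (n+i) ℓ_i(n)`. -/
theorem ell_ratio_upper (n i : ℕ) (hn : 2 ≤ n) (hi1 : 1 ≤ i) (hi2 : i ≤ n - 1) :
    (i + 1) * ell n (i + 1) ≤ (n + i) * ell n i := by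
  rw [ell_eq_card_ellLevel, ell_eq_card_ellLevel]
  calc (i + 1) * (ellLevel n (i + 1)).card
      = ∑ y ∈ ellLevel n (i + 1), ∑ j, (y j : ℕ) := by
        rw [Finset.sum_congr rfl fun y hy => mem_ellLevel.mp hy, Finset.sum_const, smul_eq_mul,
          mul_comm]
    _ = ∑ j, ∑ y ∈ ellLevel n (i + 1), (y j : ℕ) := Finset.sum_comm
    _ ≤ ∑ j, ∑ x ∈ ellLevel n i, ((x j : ℕ) + 1) :=
        Finset.sum_le_sum fun j _ => sum_apply_ellLevel_succ_le n i j
    _ = ∑ x ∈ ellLevel n i, ∑ j, ((x j : ℕ) + 1) := Finset.sum_comm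
    _ = ∑ x ∈ ellLevel n i, (n + i) := by
        refine Finset.sum_congr rfl fun x hx => ?_
        rw [Finset.sum_add_distrib, mem_ellLevel.mp hx]
        simp [add_comm]
    _ = (n + i) * (ellLevel n i).card := by
        rw [Finset.sum_const, smul_eq_mul, mul_comm]
end

section
/- For all integers n ≥ 5 and 1 ≤ i ≤ n−1, we have (2n−i)·ℓ_i(n) ≤ 2(i+1)·ℓ_{i+1}(n). -/
open Polynomial in
theorem coeff_trinomial_pow (n i : ℕ) : ((1 + X + X ^ 2 : ℤ[X]) ^ n).coeff i = ell n i := by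
  have h : (1 + X + X ^ 2 : ℤ[X]) ^ n = ∑ x : Fin n → Fin 3, X ^ (∑ j, (x j : ℕ)) := by
    have h3 : (1 + X + X ^ 2 : ℤ[X]) = ∑ k : Fin 3, X ^ (k : ℕ) := by
      simp [Fin.sum_univ_three]
    rw [h3, ← Fin.prod_const, Finset.prod_univ_sum]
    simp [Finset.prod_pow_eq_pow_sum]
  rw [h, finsetSum_coeff, ell, Nat.card_eq_fintype_card, Fintype.card_subtype]
  simp [coeff_X_pow, eq_comm]

open Polynomial in
theorem ell_recurrence (n k : ℕ) :
    ((k : ℤ) + 2) * ell n (k + 2) =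
      ((n : ℤ) - (k + 1)) * ell n (k + 1) + (2 * n - k) * ell n k := by
  have h : derivative ((1 + X + X ^ 2 : ℤ[X]) ^ n) * (1 + X + X ^ 2) =
      C (n : ℤ) * ((1 + X + X ^ 2) ^ n * (1 + C 2 * X)) := by
    cases n with
    | zero => simp
    | succ m =>
      simp [derivative_pow]
      ring
  have hx : (derivative ((1 + X + X ^ 2 : ℤ[X]) ^ n) * X).coeff k = (k : ℤ) * ell n k := by
    cases k with
    | zero => simp
    | succ k =>
      rw [coeff_mul_X, coeff_derivative, coeff_trinomial_pow]
      push_cast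
      ring
  have e : ∀ p q : ℤ[X], p * (1 + X + X ^ 2) = p + p * X + p * X * X ∧
      q * (1 + C 2 * X) = q + C 2 * (q * X) := fun p q => ⟨by ring, by ring⟩
  have hc := congrArg (fun p => coeff p (k + 1)) h
  simp only [(e _ 0).1, (e 0 _).2, coeff_add, coeff_C_mul, coeff_mul_X, hx, coeff_derivative,
    coeff_trinomial_pow] at hc
  push_cast at hc
  linarith

theorem ell_zero_right (n : ℕ) : (ell n 0 : ℤ) = 1 := by
  rw [← coeff_trinomial_pow, Polynomial.coeff_zero_eq_eval_zero]
  simp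

theorem ell_one_right (n : ℕ) : (ell n 1 : ℤ) = n := by
  rw [← coeff_trinomial_pow]
  have h := Polynomial.coeff_derivative ((1 + Polynomial.X + Polynomial.X ^ 2 : Polynomial ℤ) ^ n) 0
  rw [Polynomial.coeff_zero_eq_eval_zero] at h
  simpa [Polynomial.derivative_pow] using h.symm

/-- The ratio inequality over `ℤ`, valid for every `i < n`. -/
theorem ell_ratio_lower_int (n : ℕ) : ∀ i : ℕ, i < n →
    (2 * (n : ℤ) - i) * ell n i ≤ 2 * (i + 1) * ell n (i + 1)
  | 0, _ => by
    simp [ell_zero_right, ell_one_right]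
  | 1, h => by
    have hr := ell_recurrence n 0
    have h1 := ell_one_right n
    have h0 := ell_zero_right n
    simp only [zero_add, Nat.cast_zero, Nat.cast_one] at *
    rw [h0, h1] at hr
    rw [h1]
    norm_num at hr ⊢
    nlinarith
  | i + 2, h => by
    have ih := ell_ratio_lower_int n i (by omega)
    have hr := ell_recurrence n i
    have hr' := ell_recurrence n (i + 1)
    have hi : (i : ℤ) + 2 < n := by exact_mod_cast h
    have hp : 0 ≤ ((n : ℤ) - i - 1) * ell n (i + 1) :=
      mul_nonneg (by linarith) (by positivity)
    push_cast at *
    rw [show i + 1 + 1 = i + 2 from rfl, show i + 1 + 2 = i + 2 + 1 from rfl] at hr'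
    linarith

/-- For `n ≥ 5` and `1 ≤ i ≤ n-1`, `(2n-i) ℓ_i(n) ≤ 2(i+1) ℓ_{i+1}(n)`. -/
theorem ell_ratio_lower (n i : ℕ) (hn : 5 ≤ n) (hi1 : 1 ≤ i) (hi2 : i ≤ n - 1) :
    (2 * n - i) * ell n i ≤ 2 * (i + 1) * ell n (i + 1) := by
  have h := ell_ratio_lower_int n i (by omega)
  zify [show i ≤ 2 * n by omega]
  exact h
end

section
/- For all integers n ≥ 5, we have (n+2)/n ≤ ℓ_{n−1}(n)/ℓ_{n−2}(n) ≤ (4n+7)/(4n−2), where the bounds are rational numbers. -/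
open Polynomial in
theorem ell_eq_coeff (n i : ℕ) : (ell n i : ℤ) = ((1 + X + X ^ 2 : ℤ[X]) ^ n).coeff i := by
  have h : (1 + X + X ^ 2 : ℤ[X]) = ∑ j : Fin 3, X ^ (j : ℕ) := by
    simp [Fin.sum_univ_three]
  have hpow : (1 + X + X ^ 2 : ℤ[X]) ^ n = ∑ x : Fin n → Fin 3, X ^ (∑ j, (x j : ℕ)) := by
    rw [h, Fintype.sum_pow]
    simp_rw [Finset.prod_pow_eq_pow_sum]
  rw [hpow, finsetSum_coeff, ell, Nat.card_eq_fintype_card, Fintype.card_subtype]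
  simp [coeff_X_pow, eq_comm]

theorem ell_succ (n i : ℕ) :
    ell (n + 1) (i + 2) = ell n i + ell n (i + 1) + ell n (i + 2) := by
  zify
  simp only [ell_eq_coeff, pow_succ _ n, mul_add, mul_one, Polynomial.coeff_add,
    Polynomial.coeff_mul_X, Polynomial.coeff_mul_X_pow]
  ring

/-- The recurrence along a row, read off from `P * (P ^ n)' = n * P' * P ^ n` with
`P = 1 + X + X ^ 2`. -/
theorem ell_row_recurrence (n i : ℕ) :
    ((i : ℤ) + 2) * ell n (i + 2) = (n - i - 1) * ell n (i + 1) + (2 * n - i) * ell n i := by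
  open Polynomial in
  have hder : derivative ((1 + X + X ^ 2 : ℤ[X]) ^ n) * (1 + X + X ^ 2) =
      C (n : ℤ) * (1 + X + X ^ 2) ^ n + C (2 * n : ℤ) * (1 + X + X ^ 2) ^ n * X := by
    cases n with
    | zero => simp
    | succ n =>
      rw [derivative_pow]
      simp
      ring
  have hcoeff := congrArg (fun p => Polynomial.coeff p (i + 1)) hder
  cases i with
  | zero =>
    simp [mul_add, pow_two, ← mul_assoc, Polynomial.coeff_derivative] at hcoeff
    simp only [ell_eq_coeff]
    simp [pow_two]
    linarith
  | succ i =>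
    simp only [mul_add, mul_one, pow_two, ← mul_assoc, Polynomial.coeff_add,
      Polynomial.coeff_mul_X, Polynomial.coeff_derivative, Polynomial.coeff_C_mul] at hcoeff
    simp only [ell_eq_coeff]
    push_cast at hcoeff ⊢
    simp only [pow_two]
    linarith

theorem ell_near_middle_bounds (k : ℕ) (hk : 2 ≤ k) :
    0 < ell (k + 3) (k + 1) ∧
    (4 * (k : ℤ) + 20) * ell (k + 3) (k + 1) ≤ (4 * k + 11) * ell (k + 3) (k + 2) ∧
    (4 * (k : ℤ) + 10) * ell (k + 3) (k + 2) ≤ (4 * k + 19) * ell (k + 3) (k + 1) := by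
  induction k, hk using Nat.le_induction with
  | base =>
    have h3 : ell 5 3 = 30 := by
      rw [ell, Nat.card_eq_fintype_card]
      decide +kernel
    have h4 : ell 5 4 = 45 := by
      rw [ell, Nat.card_eq_fintype_card]
      decide +kernel
    norm_num [h3, h4]
  | succ k hk ih =>
    obtain ⟨hpos, hlow, hupp⟩ := ih
    have hr₀ := ell_row_recurrence (k + 3) k
    have hr₁ := ell_row_recurrence (k + 3) (k + 1)
    have hs₁ := ell_succ (k + 3) k
    have hs₂ := ell_succ (k + 3) (k + 1)
    simp only [show k + 1 + 3 = k + 3 + 1 by ring, show k + 1 + 1 = k + 2 by ring,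
      show k + 1 + 2 = k + 3 by ring] at *
    refine ⟨by omega, ?_⟩
    generalize ell (k + 3 + 1) (k + 3) = b' at *
    generalize ell (k + 3 + 1) (k + 2) = c' at *
    generalize ell (k + 3) k = d at *
    generalize ell (k + 3) (k + 1) = c at *
    generalize ell (k + 3) (k + 2) = b at *
    generalize ell (k + 3) (k + 3) = a at *
    zify at *
    have hb : ((k : ℤ) + 3) * b' = (k + 4) * (b + 2 * c) := by
      rw [hs₂]; linear_combination hr₁
    have hc : ((k : ℤ) + 6) * c' = (k + 4) * (2 * b + c) := by
      rw [hs₁]; linear_combination -hr₀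
    have hposM : (0 : ℤ) < (k + 3) * (k + 6) := by positivity
    constructor
    · have key : 0 ≤ (4 * (k : ℤ) + 15) * (k + 6) * (b + 2 * c)
          - (4 * k + 24) * (k + 3) * (2 * b + c) := by
        refine (mul_nonneg_iff_of_pos_left (show (0 : ℤ) < 4 * k + 10 by positivity)).1 ?_
        have hres : 0 ≤ (9 * (k : ℤ) + 54) * c := by positivity
        linear_combination (4 * (k : ℤ) ^ 2 + 33 * k + 54) * hupp + hres
      refine le_of_mul_le_mul_left ?_ hposM
      linear_combination ((k : ℤ) + 4) * key - (4 * k + 15) * (k + 6) * hb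
        + (4 * k + 24) * (k + 3) * hc
    · have key : 0 ≤ (4 * (k : ℤ) + 23) * (k + 3) * (2 * b + c)
          - (4 * k + 14) * (k + 6) * (b + 2 * c) := by
        refine (mul_nonneg_iff_of_pos_left (show (0 : ℤ) < 4 * k + 11 by positivity)).1 ?_
        have hres : 0 ≤ 9 * ((k : ℤ) - 1) * c :=
          mul_nonneg (by linarith) hpos.le
        linear_combination (4 * (k : ℤ) ^ 2 + 32 * k + 54) * hlow + hres
      refine le_of_mul_le_mul_left ?_ hposM
      linear_combination ((k : ℤ) + 4) * key - (4 * k + 23) * (k + 3) * hc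
        + (4 * k + 14) * (k + 6) * hb

/-- For `n ≥ 5`, `(n+2)/n ≤ ℓ_{n-1}(n)/ℓ_{n-2}(n) ≤ (4n+7)/(4n-2)`. -/
theorem ell_ratio_nsub2 (n : ℕ) (hn : 5 ≤ n) :
    ((n : ℚ) + 2) / (n : ℚ) ≤ (ell n (n - 1) : ℚ) / (ell n (n - 2) : ℚ) ∧
    (ell n (n - 1) : ℚ) / (ell n (n - 2) : ℚ) ≤ (4 * (n : ℚ) + 7) / (4 * (n : ℚ) - 2) := by
  obtain ⟨k, rfl⟩ : ∃ k, n = k + 3 := ⟨n - 3, by omega⟩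
  obtain ⟨hpos, hlow, hupp⟩ := ell_near_middle_bounds k (by omega)
  simp only [show k + 3 - 1 = k + 2 by omega, show k + 3 - 2 = k + 1 by omega]
  generalize ell (k + 3) (k + 1) = c at *
  generalize ell (k + 3) (k + 2) = b at *
  have hpos' : (0 : ℚ) < c := by exact_mod_cast hpos
  have hlow' : (4 * (k : ℚ) + 20) * c ≤ (4 * k + 11) * b := by exact_mod_cast hlow
  have hupp' : (4 * (k : ℚ) + 10) * b ≤ (4 * k + 19) * c := by exact_mod_cast hupp
  have hk : (0 : ℚ) ≤ k := k.cast_nonneg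
  push_cast
  constructor
  · rw [div_le_div_iff₀ (by positivity) hpos']
    refine le_of_mul_le_mul_left ?_ (show (0 : ℚ) < 4 * k + 11 by positivity)
    nlinarith [mul_nonneg hk hpos'.le]
  · rw [div_le_div_iff₀ hpos' (by linarith)]
    linarith
end
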